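/- arXiv:1507.07727 — 3 statements merged into one kernel-verified Lean document; each statement's English description precedes it below -/
import Mathlib

section
/- Let G = (V, E) be a digraph rooted at v, let u be any vertex of G, and let D = dom_G(u) be the set of vertices dominated by u. Then κ(G) = κ(root_u(G[D])) · κ(G(D → u)). -/
open MvPolynomial

/-- A finite directed (multi)graph with abstractly named edges: a finite set of
vertices, a finite set of edge names, and source/target maps.  Edge names double
as the labels/variables of the Kirchhoff polynomial. -/
structure MultiDigraph (V : Type*) (ε : Type*) where
  verts : Finset V
  edges : Finset ε
  src : ε → V
  tgt : ε → V

namespace MultiDigraph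

variable {V : Type*} {ε : Type*} [DecidableEq V] [DecidableEq ε]

/-- One step along an edge of `A`. -/
def Step (G : MultiDigraph V ε) (A : Finset ε) (x y : V) : Prop :=
  ∃ e ∈ A, G.src e = x ∧ G.tgt e = y

/-- Directed reachability using only edges of `A`. -/
def Reaches (G : MultiDigraph V ε) (A : Finset ε) (x y : V) : Prop :=
  Relation.ReflTransGen (G.Step A) x y

/-- Every edge has both of its endpoints among the vertices. -/
def WellFormed (G : MultiDigraph V ε) : Prop :=
  ∀ e ∈ G.edges, G.src e ∈ G.verts ∧ G.tgt e ∈ G.verts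

/-- `G` is a simple digraph: it has no loops and no parallel edges. -/
def Simple (G : MultiDigraph V ε) : Prop :=
  (∀ e ∈ G.edges, G.src e ≠ G.tgt e) ∧
    ∀ e ∈ G.edges, ∀ e' ∈ G.edges, G.src e = G.src e' → G.tgt e = G.tgt e' → e = e'

/-- `A` is (the edge set of) an arborescence of `G` rooted at `r`: a spanning
subdigraph in which every vertex other than the root has exactly one incoming
edge, the root has none, and every vertex is reachable from the root (hence
along a unique directed path). -/
def IsArbAt (G : MultiDigraph V ε) (A : Finset ε) (r : V) : Prop :=
  A ⊆ G.edges ∧ r ∈ G.verts ∧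
  (∀ e ∈ A, G.src e ∈ G.verts ∧ G.tgt e ∈ G.verts) ∧
  (∀ e ∈ A, G.tgt e ≠ r) ∧
  (∀ w ∈ G.verts, w ≠ r → ∃! e, e ∈ A ∧ G.tgt e = w) ∧
  (∀ w ∈ G.verts, G.Reaches A r w)

/-- `A` is an arborescence of `G` (rooted at some vertex). -/
def IsArb (G : MultiDigraph V ε) (A : Finset ε) : Prop :=
  ∃ r, G.IsArbAt A r

open Classical in
/-- The Kirchhoff polynomial of `G`: the sum, over all arborescences, of the
products of the variables of their edges. -/
noncomputable def kirchhoff (G : MultiDigraph V ε) : MvPolynomial ε ℚ :=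
  ∑ A ∈ G.edges.powerset.filter (fun A => G.IsArb A), ∏ e ∈ A, X e

open Classical in
/-- The Kirchhoff polynomial of arborescences of `G` rooted at `r`. -/
noncomputable def kirchhoffAt (G : MultiDigraph V ε) (r : V) : MvPolynomial ε ℚ :=
  ∑ A ∈ G.edges.powerset.filter (fun A => G.IsArbAt A r), ∏ e ∈ A, X e

/-- The incoming edges of vertex `v`. -/
def inEdges (G : MultiDigraph V ε) (v : V) : Finset ε :=
  G.edges.filter (fun e => G.tgt e = v)

/-- `G` is rooted at `v`: `v` has no incoming edges and every vertex is
reachable from `v`. -/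
def RootedAt (G : MultiDigraph V ε) (v : V) : Prop :=
  v ∈ G.verts ∧ (∀ e ∈ G.edges, G.tgt e ≠ v) ∧ ∀ w ∈ G.verts, G.Reaches G.edges v w

/-- `G` is strongly connected. -/
def StronglyConnected (G : MultiDigraph V ε) : Prop :=
  ∀ x ∈ G.verts, ∀ y ∈ G.verts, G.Reaches G.edges x y

/-- `G` is (weakly) connected. -/
def WeaklyConnected (G : MultiDigraph V ε) : Prop :=
  ∀ x ∈ G.verts, ∀ y ∈ G.verts,
    Relation.ReflTransGen (fun a b => G.Step G.edges a b ∨ G.Step G.edges b a) x y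

/-- The induced subdigraph `G[D]`. -/
def induce (G : MultiDigraph V ε) (D : Finset V) : MultiDigraph V ε where
  verts := D
  edges := G.edges.filter (fun e => G.src e ∈ D ∧ G.tgt e ∈ D)
  src := G.src
  tgt := G.tgt

/-- `root_u(G)`: remove all edges incoming to `u`. -/
def rootAt (G : MultiDigraph V ε) (u : V) : MultiDigraph V ε where
  verts := G.verts
  edges := G.edges.filter (fun e => G.tgt e ≠ u)
  src := G.src
  tgt := G.tgt

/-- Delete a single edge. -/
def deleteEdge (G : MultiDigraph V ε) (e₀ : ε) : MultiDigraph V ε where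
  verts := G.verts
  edges := G.edges.erase e₀
  src := G.src
  tgt := G.tgt

/-- The contraction `G(S → u)`: all edges from `Vᶜ∖S` into `S∖{u}` and all edges
inside `S` are removed, and `S` is contracted into the single vertex `u`;
edges retain their names (labels). -/
def contract (G : MultiDigraph V ε) (S : Finset V) (u : V) : MultiDigraph V ε where
  verts := insert u (G.verts \ S)
  edges := G.edges.filter (fun e => G.tgt e ∉ S ∨ (G.src e ∉ S ∧ G.tgt e = u))
  src := fun e => if G.src e ∈ S then u else G.src e
  tgt := fun e => if G.tgt e ∈ S then u else G.tgt e

/-- Directed walks from `x` to `y`, given as lists of edges taken from `A`. -/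
def IsWalk (G : MultiDigraph V ε) (A : Finset ε) : List ε → V → V → Prop
  | [], x, y => x = y
  | e :: p, x, y => e ∈ A ∧ G.src e = x ∧ IsWalk G A p (G.tgt e) y

/-- A simple directed path from `x` to `y` (no repeated vertices). -/
def IsPath (G : MultiDigraph V ε) (A : Finset ε) (p : List ε) (x y : V) : Prop :=
  G.IsWalk A p x y ∧ (x :: p.map G.tgt).Nodup

/-- A simple directed cycle through `x` (no repeated vertices). -/
def IsCycle (G : MultiDigraph V ε) (A : Finset ε) (p : List ε) (x : V) : Prop :=
  p ≠ [] ∧ G.IsWalk A p x x ∧ (p.map G.tgt).Nodup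

/-- The edge set `A` contains no directed cycle. -/
def Acyclic (G : MultiDigraph V ε) (A : Finset ε) : Prop :=
  ¬ ∃ p x, G.IsCycle A p x

/-- In `G` rooted at `v`, vertex `u` dominates vertex `w`: every directed path
from `v` to `w` passes through `u`. -/
def Dominates (G : MultiDigraph V ε) (v u w : V) : Prop :=
  ∀ p : List ε, G.IsPath G.edges p v w → u ∈ v :: p.map G.tgt

open Classical in
/-- `dom_G(u)` (w.r.t. the root `v`): the set of all vertices dominated by `u`. -/
noncomputable def domSet (G : MultiDigraph V ε) (v u : V) : Finset V :=
  G.verts.filter (fun w => G.Dominates v u w)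

/-- In `G` rooted at `v`, `y` is an immediate dominator of `z`. -/
def ImmDominates (G : MultiDigraph V ε) (v y z : V) : Prop :=
  y ≠ z ∧ G.Dominates v y z ∧
    ∀ x ∈ G.verts, x ≠ y → x ≠ z → G.Dominates v x z → G.Dominates v x y

open Classical in
/-- `imm_G(y)` (w.r.t. the root `v`): the set of vertices immediately dominated by `y`. -/
noncomputable def immSet (G : MultiDigraph V ε) (v y : V) : Finset V :=
  G.verts.filter (fun z => G.ImmDominates v y z)

open Classical in
/-- The simultaneous contraction `G(dom(z₁) → z₁; …; dom(z_i) → z_i)` for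
`Z = {z₁, …, z_i}` (domination w.r.t. the root `v`). -/
noncomputable def domContract (G : MultiDigraph V ε) (v : V) (Z : Finset V) :
    MultiDigraph V ε where
  verts := G.verts.filter (fun x => ∀ z ∈ Z, G.Dominates v z x → x = z)
  edges := G.edges.filter (fun e =>
    (∀ z ∈ Z, ¬(G.Dominates v z (G.src e) ∧ G.Dominates v z (G.tgt e))) ∧
    (∀ z ∈ Z, ¬(¬ G.Dominates v z (G.src e) ∧ G.Dominates v z (G.tgt e) ∧ G.tgt e ≠ z)))
  src := fun e =>
    if h : ∃ z ∈ Z, G.Dominates v z (G.src e) ∧ G.src e ≠ z then h.choose else G.src e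
  tgt := fun e =>
    if h : ∃ z ∈ Z, G.Dominates v z (G.tgt e) ∧ G.tgt e ≠ z then h.choose else G.tgt e

/-- Mutual directed reachability in `G`. -/
def MutuallyReachable (G : MultiDigraph V ε) (x y : V) : Prop :=
  G.Reaches G.edges x y ∧ G.Reaches G.edges y x

open Classical in
/-- `W` is (the vertex set of) a strongly connected component of `G`, i.e. an
equivalence class of mutual reachability. -/
def IsSCC (G : MultiDigraph V ε) (W : Finset V) : Prop :=
  ∃ x ∈ G.verts, W = G.verts.filter (fun y => G.MutuallyReachable x y)

/-- `W` is a minimal element in the partial order that reachability induces on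
the strongly connected components of `G` (an initial SCC). -/
def IsMinimalSCC (G : MultiDigraph V ε) (W : Finset V) : Prop :=
  G.IsSCC W ∧ ∀ W', G.IsSCC W' → (∃ x ∈ W', ∃ y ∈ W, G.Reaches G.edges x y) → W' = W

open Classical in
/-- The digraph `Ĝ(W)` associated with a strongly connected component `G[W]`:
if `G[W]` has no incoming edges (it is the initial SCC) it is `G[W]` itself;
otherwise a new auxiliary vertex (here `none`) is added and every edge of `G`
entering `W` from outside is redirected to start at the auxiliary vertex,
keeping its label. -/
noncomputable def hatSCC (G : MultiDigraph V ε) (W : Finset V) :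
    MultiDigraph (Option V) ε where
  verts :=
    if ∃ e ∈ G.edges, G.tgt e ∈ W ∧ G.src e ∉ W then insert none (W.image some)
    else W.image some
  edges := G.edges.filter (fun e => G.tgt e ∈ W)
  src := fun e => if G.src e ∈ W then some (G.src e) else none
  tgt := fun e => some (G.tgt e)

/-- `u` is an independent vertex of the simple directed cycle `C` (w.r.t. the
root `v`): `u` lies on `C` and there is a simple directed path from `v` to `u`
which is vertex-disjoint from `C` except at `u`. -/
def IsIndependentVertex (G : MultiDigraph V ε) (v : V) (C : List ε) (u : V) : Prop :=
  u ∈ C.map G.tgt ∧ ∃ p, G.IsPath G.edges p v u ∧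
    ∀ z ∈ v :: p.map G.tgt, z ∈ C.map G.tgt → z = u

end MultiDigraph

open MvPolynomial

variable {V : Type*} {ε : Type*} [DecidableEq V] [DecidableEq ε]

namespace MultiDigraph

section Walks

variable {V : Type*} {ε : Type*} {G : MultiDigraph V ε} {E : Finset ε}

theorem IsWalk.append_edge {e : ε} (he : e ∈ E) : ∀ {p : List ε} {x : V},
    G.IsWalk E p x (G.src e) → G.IsWalk E (p ++ [e]) x (G.tgt e)
  | [], _, h => ⟨he, Eq.symm h, rfl⟩
  | _ :: _, _, h => ⟨h.1, h.2.1, h.2.2.append_edge he⟩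

theorem IsWalk.target_mem_support : ∀ {p : List ε} {x y : V},
    G.IsWalk E p x y → y ∈ x :: p.map G.tgt
  | [], _, _, h => by simp [show _ = _ from h]
  | _ :: _, _, _, h => List.mem_cons_of_mem _ h.2.2.target_mem_support

theorem IsWalk.exists_prefix : ∀ {p : List ε} {x y c : V}, G.IsWalk E p x y →
    c ∈ x :: p.map G.tgt → ∃ q, q <+: p ∧ G.IsWalk E q x c
  | [], x, _, c, _, hc => ⟨[], List.prefix_rfl, by simpa [IsWalk, eq_comm] using hc⟩
  | e :: p, x, _, c, h, hc => by
    rcases List.mem_cons.1 hc with rfl | hc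
    · exact ⟨[], List.nil_prefix, rfl⟩
    · obtain ⟨q, hq, hw⟩ := h.2.2.exists_prefix hc
      exact ⟨e :: q, (List.prefix_cons_inj e).2 hq, h.1, h.2.1, hw⟩

/-- A path extended by one edge contains a path with the new endpoint. -/
theorem IsPath.exists_extend {p : List ε} {x : V} {e : ε} (he : e ∈ E)
    (hp : G.IsPath E p x (G.src e)) :
    ∃ q, G.IsPath E q x (G.tgt e) ∧
      ∀ z ∈ x :: q.map G.tgt, z ∈ x :: p.map G.tgt ∨ z = G.tgt e := by
  by_cases hc : G.tgt e ∈ x :: p.map G.tgt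
  · obtain ⟨q, hq, hw⟩ := hp.1.exists_prefix hc
    have hsub : (x :: q.map G.tgt) <+: (x :: p.map G.tgt) :=
      (List.prefix_cons_inj x).2 (hq.map G.tgt)
    exact ⟨q, ⟨hw, hp.2.sublist hsub.sublist⟩, fun z hz => Or.inl (hsub.subset hz)⟩
  · refine ⟨p ++ [e], ⟨hp.1.append_edge he, ?_⟩, ?_⟩
    · rw [List.map_append, ← List.cons_append]
      exact hp.2.append (List.nodup_singleton _) (by simpa using hc)
    · intro z hz
      rw [List.map_append, ← List.cons_append, List.mem_append] at hz
      simpa using hz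

/-- An arborescence of a digraph in which `r` has no incoming edges is rooted at `r`. -/
theorem IsArb.isArbAt {A : Finset ε} {r : V} (h : G.IsArb A) (hr : r ∈ G.verts)
    (hin : ∀ e ∈ G.edges, G.tgt e ≠ r) : G.IsArbAt A r := by
  obtain ⟨r', hA⟩ := h
  rcases Relation.ReflTransGen.cases_tail (hA.2.2.2.2.2 r hr) with h | ⟨_, _, e, he, _, ht⟩
  · exact h ▸ hA
  · exact absurd ht (hin e (hA.1 he))

end Walks

variable {V : Type*} {ε : Type*} {G : MultiDigraph V ε}

theorem mem_domSet_self {v u : V} (hu : u ∈ G.verts) : u ∈ G.domSet v u := by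
  classical
  exact Finset.mem_filter.2 ⟨hu, fun _ hp => hp.1.target_mem_support⟩

theorem eq_of_root_mem_domSet {v u : V} (h : v ∈ G.domSet v u) : v = u := by
  classical
  have := (Finset.mem_filter.1 h).2 [] ⟨rfl, by simp⟩
  simpa [eq_comm] using this

/-- An edge entering a dominated set somewhere else than at the dominator starts in that set. -/
theorem src_mem_domSet (hwf : G.WellFormed) {v u : V} {e : ε} (he : e ∈ G.edges)
    (ht : G.tgt e ∈ G.domSet v u) (hne : G.tgt e ≠ u) : G.src e ∈ G.domSet v u := by
  classical
  refine Finset.mem_filter.2 ⟨(hwf e he).1, fun p hp => ?_⟩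
  obtain ⟨q, hq, hsub⟩ := hp.exists_extend he
  exact (hsub u ((Finset.mem_filter.1 ht).2 q hq)).resolve_right (Ne.symm hne)

/-- `D` is a set of vertices that can be entered only through `u ∈ D`, and that contains the
root `v` only if `v = u`. -/
structure EnteredAt (G : MultiDigraph V ε) (D : Finset V) (v u : V) : Prop where
  subset : D ⊆ G.verts
  mem : u ∈ D
  root : v ∈ D → v = u
  src_mem : ∀ e ∈ G.edges, G.tgt e ∈ D → G.tgt e ≠ u → G.src e ∈ D

theorem domSet_enteredAt (hwf : G.WellFormed) {v u : V} (hu : u ∈ G.verts) :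
    G.EnteredAt (G.domSet v u) v u := by
  classical
  exact ⟨Finset.filter_subset _ _, mem_domSet_self hu, eq_of_root_mem_domSet,
    fun _ he => src_mem_domSet hwf he⟩

namespace EnteredAt

variable {D : Finset V} {v u : V} {A : Finset ε}

/-- In an arborescence, the edge entering `u` comes from outside of `D`. -/
theorem src_notMem (h : G.EnteredAt D v u) (hA : G.IsArbAt A v) {e : ε} (he : e ∈ A)
    (ht : G.tgt e = u) : G.src e ∉ D := by
  obtain ⟨hsub, -, -, hroot, huniq, hreach⟩ := hA
  have key : ∀ x, G.Reaches A v x → x ∉ D ∨ ∃ f ∈ A, G.tgt f = u ∧ G.src f ∉ D := by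
    intro x hx
    induction hx with
    | refl => exact Or.inl fun hv => hroot e he (ht.trans (h.root hv).symm)
    | tail _ hs ih =>
      obtain ⟨f, hf, rfl, rfl⟩ := hs
      refine ih.elim (fun hx => ?_) Or.inr
      by_cases hy : G.tgt f ∈ D
      · exact Or.inr ⟨f, hf, by_contra fun hne => hx (h.src_mem f (hsub hf) hy hne), hx⟩
      · exact Or.inl hy
  have huV := h.subset h.mem
  obtain ⟨f, hf, hfu, hfD⟩ := (key u (hreach u huV)).resolve_left (not_not.2 h.mem)
  have huv : u ≠ v := fun huv => hroot e he (ht.trans huv)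
  rwa [(huniq u huV huv).unique ⟨he, ht⟩ ⟨hf, hfu⟩]

variable [DecidableEq V]

theorem mem_inner (e : ε) : e ∈ ((G.induce D).rootAt u).edges ↔
    e ∈ G.edges ∧ G.src e ∈ D ∧ G.tgt e ∈ D ∧ G.tgt e ≠ u := by
  refine Finset.mem_filter.trans ?_
  rw [show e ∈ (G.induce D).edges ↔ _ from Finset.mem_filter, and_assoc, and_assoc]
  rfl

theorem mem_outer (e : ε) : e ∈ (G.contract D u).edges ↔
    e ∈ G.edges ∧ (G.tgt e ∉ D ∨ (G.src e ∉ D ∧ G.tgt e = u)) := by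
  simp [contract]

theorem contract_tgt {e : ε} (he : e ∈ (G.contract D u).edges) :
    (G.contract D u).tgt e = G.tgt e := by
  rw [mem_outer] at he
  simp only [contract]
  split_ifs with h
  · exact ((he.2.resolve_left (not_not.2 h)).2).symm
  · rfl

theorem disjoint_edges :
    Disjoint ((G.induce D).rootAt u).edges (G.contract D u).edges := by
  rw [Finset.disjoint_left]
  intro e h1 h2
  rw [mem_inner] at h1
  rw [mem_outer] at h2
  tauto

theorem root_mem_contract (h : G.EnteredAt D v u) (hv : v ∈ G.verts) :
    v ∈ (G.contract D u).verts := by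
  simp only [contract, Finset.mem_insert, Finset.mem_sdiff]
  by_cases hD : v ∈ D
  · exact Or.inl (h.root hD)
  · exact Or.inr ⟨hv, hD⟩

variable [DecidableEq ε]

theorem subset_union (h : G.EnteredAt D v u) (hA : G.IsArbAt A v) :
    A ⊆ ((G.induce D).rootAt u).edges ∪ (G.contract D u).edges := by
  intro e he
  have heG := hA.1 he
  have h1 := h.src_mem e heG
  have h2 := h.src_notMem hA he
  rw [Finset.mem_union, mem_inner, mem_outer]
  tauto

theorem isArbAt_inner (h : G.EnteredAt D v u) (hA : G.IsArbAt A v) :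
    ((G.induce D).rootAt u).IsArbAt (A ∩ ((G.induce D).rootAt u).edges) u := by
  obtain ⟨hsub, -, -, -, huniq, hreach⟩ := hA
  have key : ∀ x, G.Reaches A v x → x ∈ D →
      ((G.induce D).rootAt u).Reaches (A ∩ ((G.induce D).rootAt u).edges) u x := by
    intro x hx
    induction hx with
    | refl => exact fun hv => h.root hv ▸ .refl
    | tail _ hs ih =>
      obtain ⟨f, hf, rfl, rfl⟩ := hs
      intro hy
      by_cases hyu : G.tgt f = u
      · exact hyu ▸ .refl
      · have hx := h.src_mem f (hsub hf) hy hyu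
        exact (ih hx).tail
          ⟨f, Finset.mem_inter.2 ⟨hf, (mem_inner f).2 ⟨hsub hf, hx, hy, hyu⟩⟩, rfl, rfl⟩
  refine ⟨Finset.inter_subset_right, h.mem, ?_, ?_, ?_,
    fun w hw => key w (hreach w (h.subset hw)) hw⟩
  · intro e he
    have := (mem_inner e).1 (Finset.mem_inter.1 he).2
    exact ⟨this.2.1, this.2.2.1⟩
  · intro e he
    exact ((mem_inner e).1 (Finset.mem_inter.1 he).2).2.2.2
  · intro w hw hwu
    have hwD : w ∈ D := hw
    obtain ⟨e, ⟨he, rfl⟩, hu⟩ := huniq w (h.subset hw) fun hwv => hwu (by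
      subst hwv; exact h.root hwD)
    refine ⟨e, ⟨Finset.mem_inter.2 ⟨he, (mem_inner e).2
      ⟨hsub he, h.src_mem e (hsub he) hwD hwu, hwD, hwu⟩⟩, rfl⟩, ?_⟩
    rintro f ⟨hf, hfw⟩
    exact hu f ⟨(Finset.mem_inter.1 hf).1, hfw⟩

theorem isArbAt_outer (h : G.EnteredAt D v u) (hA : G.IsArbAt A v) :
    (G.contract D u).IsArbAt (A ∩ (G.contract D u).edges) v := by
  have hsplit := h.subset_union hA
  have hsrc := fun e => h.src_notMem hA (e := e)
  obtain ⟨hsub, hv, hends, hroot, huniq, hreach⟩ := hA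
  have hverts : ∀ x ∈ G.verts, (if x ∈ D then u else x) ∈ (G.contract D u).verts := by
    intro x hx
    simp only [contract, Finset.mem_insert, Finset.mem_sdiff]
    split_ifs with hxD
    · exact Or.inl rfl
    · exact Or.inr ⟨hx, hxD⟩
  have key : ∀ x, G.Reaches A v x →
      (G.contract D u).Reaches (A ∩ (G.contract D u).edges) v (if x ∈ D then u else x) := by
    intro x hx
    induction hx with
    | refl =>
      split_ifs with hvD
      · exact h.root hvD ▸ .refl
      · exact .refl
    | tail _ hs ih =>
      obtain ⟨f, hf, rfl, rfl⟩ := hs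
      rcases Finset.mem_union.1 (hsplit hf) with hfi | hfo
      · obtain ⟨-, hx, hy, -⟩ := (mem_inner f).1 hfi
        rw [if_pos hx] at ih
        rwa [if_pos hy]
      · exact ih.tail ⟨f, Finset.mem_inter.2 ⟨hf, hfo⟩, rfl, rfl⟩
  refine ⟨Finset.inter_subset_right, h.root_mem_contract hv, ?_, ?_, ?_, ?_⟩
  · intro e he
    have := hends e (Finset.mem_inter.1 he).1
    exact ⟨hverts _ this.1, hverts _ this.2⟩
  · intro e he
    rw [Finset.mem_inter] at he
    rw [contract_tgt he.2]
    exact hroot e he.1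
  · intro w hw hwv
    have hw' : w = u ∨ w ∈ G.verts ∧ w ∉ D := by simpa [contract] using hw
    have hwV : w ∈ G.verts := hw'.elim (fun hwu => hwu ▸ h.subset h.mem) And.left
    obtain ⟨e, ⟨he, rfl⟩, hu⟩ := huniq w hwV hwv
    have heo : e ∈ (G.contract D u).edges := by
      have := hsrc e he
      rw [mem_outer]
      exact ⟨hsub he, by tauto⟩
    refine ⟨e, ⟨Finset.mem_inter.2 ⟨he, heo⟩, contract_tgt heo⟩, ?_⟩
    rintro f ⟨hf, hfw⟩
    rw [Finset.mem_inter] at hf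
    exact hu f ⟨hf.1, (contract_tgt hf.2).symm.trans hfw⟩
  · intro w hw
    have hw' : w = u ∨ w ∈ G.verts ∧ w ∉ D := by simpa [contract] using hw
    rcases hw' with rfl | ⟨hwV, hwD⟩
    · simpa [h.mem] using key w (hreach w (h.subset h.mem))
    · simpa [hwD] using key w (hreach w hwV)

theorem isArbAt_union (hwf : G.WellFormed) (hv : v ∈ G.verts)
    (hin : ∀ e ∈ G.edges, G.tgt e ≠ v) {B C : Finset ε}
    (hB : ((G.induce D).rootAt u).IsArbAt B u) (hC : (G.contract D u).IsArbAt C v) :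
    G.IsArbAt (B ∪ C) v := by
  obtain ⟨hBsub, -, -, -, hBuniq, hBreach⟩ := hB
  obtain ⟨hCsub, -, -, -, hCuniq, hCreach⟩ := hC
  have hsub : B ∪ C ⊆ G.edges := Finset.union_subset
    (fun e he => ((mem_inner e).1 (hBsub he)).1) (fun e he => ((mem_outer e).1 (hCsub he)).1)
  have hD : ∀ y ∈ D, G.Reaches (B ∪ C) u y := fun y hy =>
    Relation.ReflTransGen.mono
      (fun _ _ ⟨e, he, hs⟩ => ⟨e, Finset.mem_union_left _ he, hs⟩) _ _ (hBreach y hy)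
  have key : ∀ x, (G.contract D u).Reaches C v x → G.Reaches (B ∪ C) v x := by
    intro x hx
    induction hx with
    | refl => exact .refl
    | tail _ hs ih =>
      obtain ⟨f, hf, rfl, rfl⟩ := hs
      rw [contract_tgt (hCsub hf)]
      have hstep : G.Step (B ∪ C) (G.src f) (G.tgt f) :=
        ⟨f, Finset.mem_union_right _ hf, rfl, rfl⟩
      by_cases hx : G.src f ∈ D
      · simp only [contract, if_pos hx] at ih
        exact (ih.trans (hD _ hx)).tail hstep
      · simp only [contract, if_neg hx] at ih
        exact ih.tail hstep
  refine ⟨hsub, hv, fun e he => hwf e (hsub he), fun e he => hin e (hsub he), ?_, ?_⟩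
  · intro w hw hwv
    by_cases hwi : w ∈ D ∧ w ≠ u
    · obtain ⟨e, ⟨he, hew⟩, hu⟩ := hBuniq w hwi.1 hwi.2
      refine ⟨e, ⟨Finset.mem_union_left _ he, hew⟩, ?_⟩
      rintro f ⟨hf, rfl⟩
      rcases Finset.mem_union.1 hf with hf | hf
      · exact hu f ⟨hf, rfl⟩
      · have := (mem_outer f).1 (hCsub hf)
        tauto
    · have hwC : w ∈ (G.contract D u).verts := by
        simp only [contract, Finset.mem_insert, Finset.mem_sdiff]
        tauto
      obtain ⟨e, ⟨he, hew⟩, hu⟩ := hCuniq w hwC hwv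
      refine ⟨e, ⟨Finset.mem_union_right _ he, (contract_tgt (hCsub he)).symm.trans hew⟩, ?_⟩
      rintro f ⟨hf, rfl⟩
      rcases Finset.mem_union.1 hf with hf | hf
      · have := (mem_inner f).1 (hBsub hf)
        tauto
      · exact hu f ⟨hf, contract_tgt (hCsub hf)⟩
  · intro w hw
    by_cases hwD : w ∈ D
    · exact (key u (hCreach u (Finset.mem_insert_self _ _))).trans (hD w hwD)
    · exact key w (hCreach w (Finset.mem_insert_of_mem (Finset.mem_sdiff.2 ⟨hw, hwD⟩)))

theorem kirchhoff_eq_mul (hwf : G.WellFormed) (h : G.EnteredAt D v u) (hv : v ∈ G.verts)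
    (hin : ∀ e ∈ G.edges, G.tgt e ≠ v) :
    G.kirchhoff = ((G.induce D).rootAt u).kirchhoff * (G.contract D u).kirchhoff := by
  classical
  have hinner : ∀ {B}, ((G.induce D).rootAt u).IsArb B → ((G.induce D).rootAt u).IsArbAt B u :=
    fun hB => hB.isArbAt h.mem fun e he => ((mem_inner e).1 he).2.2.2
  have houter : ∀ {C}, (G.contract D u).IsArb C → (G.contract D u).IsArbAt C v :=
    fun hC => hC.isArbAt (h.root_mem_contract hv) fun e he => by
      rw [contract_tgt he]
      exact hin e ((mem_outer e).1 he).1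
  have hdisj := disjoint_edges (G := G) (D := D) (u := u)
  unfold kirchhoff
  rw [Finset.sum_mul_sum, ← Finset.sum_product']
  symm
  refine Finset.sum_bij' (fun P _ => P.1 ∪ P.2)
    (fun A _ => (A ∩ ((G.induce D).rootAt u).edges, A ∩ (G.contract D u).edges)) ?_ ?_ ?_ ?_ ?_
  · rintro ⟨B, C⟩ hP
    simp only [Finset.mem_product, Finset.mem_filter, Finset.mem_powerset] at hP ⊢
    have := isArbAt_union hwf hv hin (hinner hP.1.2) (houter hP.2.2)
    exact ⟨this.1, v, this⟩
  · intro A hA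
    simp only [Finset.mem_product, Finset.mem_filter, Finset.mem_powerset] at hA ⊢
    have hA' := hA.2.isArbAt hv hin
    exact ⟨⟨Finset.inter_subset_right, u, h.isArbAt_inner hA'⟩,
      Finset.inter_subset_right, v, h.isArbAt_outer hA'⟩
  · rintro ⟨B, C⟩ hP
    simp only [Finset.mem_product, Finset.mem_filter, Finset.mem_powerset] at hP
    have hCi := Finset.disjoint_iff_inter_eq_empty.1 (hdisj.symm.mono_left hP.2.1)
    have hBo := Finset.disjoint_iff_inter_eq_empty.1 (hdisj.mono_left hP.1.1)
    simp only [Finset.union_inter_distrib_right, hCi, hBo, Finset.inter_eq_left.2 hP.1.1,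
      Finset.inter_eq_left.2 hP.2.1, Finset.union_empty, Finset.empty_union]
  · intro A hA
    simp only [Finset.mem_filter] at hA
    simp only [← Finset.inter_union_distrib_left]
    exact Finset.inter_eq_left.2 (h.subset_union (hA.2.isArbAt hv hin))
  · rintro ⟨B, C⟩ hP
    simp only [Finset.mem_product, Finset.mem_filter, Finset.mem_powerset] at hP
    exact (Finset.prod_union (hdisj.mono hP.1.1 hP.2.1)).symm

end EnteredAt

end MultiDigraph

/-- Let `G` be rooted at `v`, let `u` be any vertex and
`D = dom_G(u)`.  Then `κ(G) = κ(root_u(G[D])) · κ(G(D → u))`. -/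
theorem statement_8 (G : MultiDigraph V ε) (hwf : G.WellFormed) (hsimple : G.Simple)
    (v : V) (hroot : G.RootedAt v) (u : V) (hu : u ∈ G.verts) :
    G.kirchhoff =
      ((G.induce (G.domSet v u)).rootAt u).kirchhoff *
        (G.contract (G.domSet v u) u).kirchhoff := by
  exact (MultiDigraph.domSet_enteredAt hwf hu).kirchhoff_eq_mul hwf hroot.1 hroot.2.1
end

section
/- Let G = (V, E) be a digraph rooted at v, and let H be any factor digraph obtained from G by the dominator-tree decomposition rule, i.e. H = root_u(G(dom_G(u₁) → u₁; …; dom_G(u_i) → u_i)[{u, u₁, …, u_i}]) for some vertex u with imm_G(u) = {u₁, …, u_i}. Then every factor digraph obtained from H by the strongly-connected-component decomposition rule (i.e. each Ĥ(V_j) for V_j an SCC of H) is prime: its Kirchhoff polynomial admits no factorization into two non-constant polynomials. -/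
open MvPolynomial

/-- `y` orders `U` injectively so that every vertex of `P` has, among its `R`-predecessors
in `U`, both a strictly lower and a strictly higher one. -/
def IsLowHigh {α : Type*} (R : α → α → Prop) (U P : Finset α) (y : α → ℚ) : Prop :=
  Set.InjOn y U ∧ ∀ w ∈ P, (∃ a ∈ U, R a w ∧ y a < y w) ∧ ∃ b ∈ U, R b w ∧ y w < y b

namespace IsLowHigh

variable {α : Type*} {R : α → α → Prop} {U P : Finset α} {y : α → ℚ}

theorem neg (h : IsLowHigh R U P y) : IsLowHigh R U P (fun a => -y a) := by
  refine ⟨fun a ha b hb hab => h.1 ha hb (neg_injective hab), fun w hw => ?_⟩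
  obtain ⟨⟨a, ha, hR, hlt⟩, b, hb, hR', hlt'⟩ := h.2 w hw
  exact ⟨⟨b, hb, hR', neg_lt_neg hlt'⟩, a, ha, hR, neg_lt_neg hlt⟩

theorem lt_of_forall_le {S : Finset α} (h : IsLowHigh R U P y) (hSP : S ⊆ P) {z t : α}
    (hU : ∀ a ∈ U, a ∈ S ∨ a = z ∨ a = t) (hzt : y z ≤ y t) {s : α} (hs : s ∈ S) :
    y z < y s ∧ y s < y t := by
  have hne : S.Nonempty := ⟨s, hs⟩
  constructor
  · obtain ⟨m, hm, hmin⟩ := S.exists_min_image y hne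
    obtain ⟨⟨a, ha, -, hlt⟩, -⟩ := h.2 m (hSP hm)
    have h1 := hmin s hs
    rcases hU a ha with h' | rfl | rfl
    · exact absurd (hmin a h') (not_le.2 hlt)
    · linarith
    · linarith
  · obtain ⟨m, hm, hmax⟩ := S.exists_max_image y hne
    obtain ⟨-, a, ha, -, hlt⟩ := h.2 m (hSP hm)
    have h1 := hmax s hs
    rcases hU a ha with h' | rfl | rfl
    · exact absurd (hmax a h') (not_le.2 hlt)
    · linarith
    · linarith

theorem exists_small (S T : Finset α) (f g : α → ℚ) (hg : ∀ a ∈ T, g a ≠ 0) :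
    ∃ c : ℚ, 0 < c ∧ ∀ s ∈ S, ∀ a ∈ T, c * |f s| < |g a| := by
  obtain ⟨m, hm, hmT⟩ : ∃ m : ℚ, 0 < m ∧ ∀ a ∈ T, m ≤ |g a| := by
    rcases T.eq_empty_or_nonempty with rfl | hT
    · exact ⟨1, one_pos, by simp⟩
    · obtain ⟨b, hb, hmin⟩ := T.exists_min_image (fun a => |g a|) hT
      exact ⟨|g b|, abs_pos.2 (hg b hb), hmin⟩
  have hM : 0 < ∑ s ∈ S, |f s| + 1 := by positivity
  refine ⟨m / (∑ s ∈ S, |f s| + 1), by positivity, fun s hs a ha => ?_⟩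
  refine lt_of_lt_of_le ?_ (hmT a ha)
  rw [div_mul_eq_mul_div, div_lt_iff₀ hM]
  have := Finset.single_le_sum (f := fun s => |f s|) (fun i _ => abs_nonneg _) hs
  nlinarith

variable [DecidableEq α]

/-- Insert an order of `S ∪ {z, t}` with extreme elements `z < t` right below `t`. -/
theorem glue_of_lt {S : Finset α} {t z : α} (hSU : S ⊆ U) (hPU : P ⊆ U) (htU : t ∈ U)
    (htS : t ∉ S) (hzU : z ∈ U) (hzS : z ∉ S) {yi yo : α → ℚ}
    (hi : IsLowHigh R (insert z (insert t S)) S yi)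
    (ho : IsLowHigh (fun a b => R a b ∨ (a = t ∧ ∃ s ∈ S, R s b)) (U \ S) (P \ S) yo)
    (hyi : yi z < yi t) (hyo : yo z < yo t) : ∃ y, IsLowHigh R U P y := by
  have hbt : ∀ s ∈ S, yi z < yi s ∧ yi s < yi t := fun s hs =>
    hi.lt_of_forall_le (S := S) (z := z) (t := t) (Finset.Subset.refl S)
      (by simp only [Finset.mem_insert]; tauto) hyi.le hs
  obtain ⟨c, hc, hcs⟩ := exists_small S ((U \ S).erase t) (fun s => yi s - yi t)
    (fun a => yo a - yo t) (by
      intro a ha h0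
      rw [Finset.mem_erase] at ha
      exact ha.1 (ho.1 (by exact_mod_cast ha.2) (by simp [htU, htS]) (sub_eq_zero.1 h0)))
  have hlow : ∀ s ∈ S, ∀ a ∈ U \ S, yo a < yo t → yo a < yo t + c * (yi s - yi t) := by
    intro s hs a ha hlt
    have h1 := hcs s hs a (Finset.mem_erase.2 ⟨by rintro rfl; exact lt_irrefl _ hlt, ha⟩)
    rw [abs_of_neg (sub_neg.2 (hbt s hs).2), abs_of_neg (sub_neg.2 hlt)] at h1
    linarith
  have hup : ∀ s ∈ S, yo t + c * (yi s - yi t) < yo t := by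
    intro s hs
    have := mul_neg_of_pos_of_neg hc (sub_neg.2 (hbt s hs).2)
    linarith
  set y : α → ℚ := fun a => if a ∈ S then yo t + c * (yi a - yi t) else yo a with hy
  have hyS : ∀ a ∈ S, y a = yo t + c * (yi a - yi t) := fun a ha => by simp [hy, ha]
  have hyN : ∀ a, a ∉ S → y a = yo a := fun a ha => by simp [hy, ha]
  have hne : ∀ s ∈ S, ∀ a ∈ U \ S, y s ≠ y a := by
    intro s hs a ha h
    rw [hyS s hs, hyN a (Finset.mem_sdiff.1 ha).2] at h
    have h2 := hup s hs
    exact absurd (hlow s hs a ha (by linarith)) (by linarith)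
  refine ⟨y, ?_, ?_⟩
  · intro a ha b hb hab
    by_cases haS : a ∈ S <;> by_cases hbS : b ∈ S
    · rw [hyS a haS, hyS b hbS] at hab
      refine hi.1 (by simp [haS]) (by simp [hbS]) ?_
      have := mul_left_cancel₀ hc.ne' (add_left_cancel hab)
      linarith
    · exact absurd hab (hne a haS b (Finset.mem_sdiff.2 ⟨hb, hbS⟩))
    · exact absurd hab.symm (hne b hbS a (Finset.mem_sdiff.2 ⟨ha, haS⟩))
    · rw [hyN a haS, hyN b hbS] at hab
      exact ho.1 (by simpa [haS] using ha) (by simpa [hbS] using hb) hab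
  · intro w hw
    by_cases hwS : w ∈ S
    · obtain ⟨⟨a, ha, hR, hlt⟩, b, hb, hR', hlt'⟩ := hi.2 w hwS
      rw [Finset.mem_insert, Finset.mem_insert] at ha hb
      constructor
      · rcases ha with rfl | rfl | ha
        · exact ⟨a, hzU, hR, by
            rw [hyN a hzS, hyS w hwS]
            exact hlow w hwS a (Finset.mem_sdiff.2 ⟨hzU, hzS⟩) hyo⟩
        · exact absurd (hbt w hwS).2 (not_lt.2 hlt.le)
        · refine ⟨a, hSU ha, hR, ?_⟩
          rw [hyS a ha, hyS w hwS]
          have := mul_lt_mul_of_pos_left hlt hc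
          linarith
      · rcases hb with rfl | rfl | hb
        · exact absurd (hbt w hwS).1 (not_lt.2 hlt'.le)
        · exact ⟨b, htU, hR', by rw [hyN b htS, hyS w hwS]; exact hup w hwS⟩
        · refine ⟨b, hSU hb, hR', ?_⟩
          rw [hyS b hb, hyS w hwS]
          have := mul_lt_mul_of_pos_left hlt' hc
          linarith
    · obtain ⟨⟨a, ha, hR, hlt⟩, b, hb, hR', hlt'⟩ := ho.2 w (Finset.mem_sdiff.2 ⟨hw, hwS⟩)
      rw [hyN w hwS]
      constructor
      · rcases hR with hR | ⟨rfl, s, hs, hR⟩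
        · exact ⟨a, (Finset.mem_sdiff.1 ha).1, hR, by
            rw [hyN a (Finset.mem_sdiff.1 ha).2]; exact hlt⟩
        · exact ⟨s, hSU hs, hR, by rw [hyS s hs]; exact (hup s hs).trans hlt⟩
      · rcases hR' with hR' | ⟨rfl, s, hs, hR'⟩
        · exact ⟨b, (Finset.mem_sdiff.1 hb).1, hR', by
            rw [hyN b (Finset.mem_sdiff.1 hb).2]; exact hlt'⟩
        · exact ⟨s, hSU hs, hR', by
            rw [hyS s hs]; exact hlow s hs w (Finset.mem_sdiff.2 ⟨hPU hw, hwS⟩) hlt'⟩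

theorem glue {S : Finset α} {t z : α} (hSU : S ⊆ U) (hPU : P ⊆ U) (htU : t ∈ U)
    (htS : t ∉ S) (hzU : z ∈ U) (hzS : z ∉ S) (htz : t ≠ z) {yi yo : α → ℚ}
    (hi : IsLowHigh R (insert z (insert t S)) S yi)
    (ho : IsLowHigh (fun a b => R a b ∨ (a = t ∧ ∃ s ∈ S, R s b)) (U \ S) (P \ S) yo) :
    ∃ y, IsLowHigh R U P y := by
  have hni : yi z ≠ yi t := fun h => htz (hi.1 (by simp) (by simp) h).symm
  have hno : yo z ≠ yo t := fun h =>
    htz (ho.1 (by simp [hzU, hzS]) (by simp [htU, htS]) h).symm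
  rcases hni.lt_or_gt with h1 | h1 <;> rcases hno.lt_or_gt with h2 | h2
  · exact glue_of_lt hSU hPU htU htS hzU hzS hi ho h1 h2
  · exact glue_of_lt hSU hPU htU htS hzU hzS hi ho.neg h1 (neg_lt_neg h2)
  · exact glue_of_lt hSU hPU htU htS hzU hzS hi.neg ho (neg_lt_neg h1) h2
  · exact glue_of_lt hSU hPU htU htS hzU hzS hi.neg ho.neg (neg_lt_neg h1) (neg_lt_neg h2)

end IsLowHigh

/-- If every nonempty `S ⊆ P` has at least two predecessors in `U` outside `S`, then `U` can be
ordered so that every vertex of `P` has a lower and a higher predecessor. -/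
theorem exists_isLowHigh {α : Type*} [DecidableEq α] (R : α → α → Prop) (U P : Finset α)
    (hPU : P ⊆ U)
    (hP : ∀ S ⊆ P, S.Nonempty → ∀ c, ∃ a ∈ U \ S, a ≠ c ∧ ∃ s ∈ S, R a s) :
    ∃ y, IsLowHigh R U P y := by
  induction hn : P.card using Nat.strong_induction_on generalizing R U P with
  | _ n ih =>
  rcases P.eq_empty_or_nonempty with rfl | hne
  · refine ⟨fun a => if h : a ∈ U then ((U.equivFin ⟨a, h⟩ : ℕ) : ℚ) else 0, ?_, by simp⟩
    intro a ha b hb hab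
    simp only [Finset.mem_coe] at ha hb
    simp only [ha, hb, dif_pos, Nat.cast_inj] at hab
    simpa using U.equivFin.injective (Fin.ext hab)
  obtain ⟨w₀, hw₀⟩ := hne
  obtain ⟨z, hz, -, w, hwP, hzw⟩ := hP P subset_rfl ⟨w₀, hw₀⟩ w₀
  obtain ⟨hzU, hzP⟩ := Finset.mem_sdiff.1 hz
  have hzw' : z ≠ w := by rintro rfl; exact hzP hwP
  by_cases hbad : ∃ S ⊆ P, S.Nonempty ∧ w ∉ S ∧
      ∀ a ∈ U \ S, (∃ s ∈ S, R a s) → a = z ∨ a = w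
  · classical
    obtain ⟨S, hS, hmax⟩ := (P.powerset.filter fun S => S.Nonempty ∧ w ∉ S ∧
      ∀ a ∈ U \ S, (∃ s ∈ S, R a s) → a = z ∨ a = w).exists_max_image Finset.card (by
        obtain ⟨S, hS, h⟩ := hbad
        exact ⟨S, Finset.mem_filter.2 ⟨Finset.mem_powerset.2 hS, h⟩⟩)
    rw [Finset.mem_filter, Finset.mem_powerset] at hS
    obtain ⟨hSP, hSne, hwS, hSpred⟩ := hS
    have hSU := hSP.trans hPU
    have hzS : z ∉ S := fun h => hzP (hSP h)
    obtain ⟨yi, hyi⟩ := ih S.card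
      (hn ▸ Finset.card_lt_card ⟨hSP, fun h => hwS (h hwP)⟩) R (insert z (insert w S)) S
      (fun a ha => by simp [ha]) (fun T hTS hT c => by
        obtain ⟨a, ha, hac, s, hs, hR⟩ := hP T (hTS.trans hSP) hT c
        rw [Finset.mem_sdiff] at ha
        refine ⟨a, Finset.mem_sdiff.2 ⟨?_, ha.2⟩, hac, s, hs, hR⟩
        by_cases haS : a ∈ S
        · simp [haS]
        · rcases hSpred a (Finset.mem_sdiff.2 ⟨ha.1, haS⟩) ⟨s, hTS hs, hR⟩ with rfl | rfl <;>
            simp) rfl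
    obtain ⟨yo, hyo⟩ := ih (P \ S).card
      (hn ▸ Finset.card_lt_card ⟨Finset.sdiff_subset, fun h => by
        obtain ⟨s, hs⟩ := hSne
        exact (Finset.mem_sdiff.1 (h (hSP hs))).2 hs⟩)
      (fun a b => R a b ∨ (a = w ∧ ∃ s ∈ S, R s b)) (U \ S) (P \ S)
      (Finset.sdiff_subset_sdiff hPU subset_rfl) (fun T hTP hT c => by
        have hTP' : T ⊆ P := hTP.trans Finset.sdiff_subset
        have hTS : ∀ a ∈ T, a ∉ S := fun a ha => (Finset.mem_sdiff.1 (hTP ha)).2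
        have hST : S ∪ T ⊆ P := Finset.union_subset hSP hTP'
        by_cases hwT : w ∈ T
        · obtain ⟨a, ha, hac, s, hs, hR⟩ := hP (S ∪ T) hST (hT.mono Finset.subset_union_right) c
          simp only [Finset.mem_sdiff, Finset.mem_union, not_or] at ha hs
          refine ⟨a, by simp [ha], hac, ?_⟩
          rcases hs with hs | hs
          · rcases hSpred a (by simp [ha]) ⟨s, hs, hR⟩ with rfl | rfl
            · exact ⟨w, hwT, Or.inl hzw⟩
            · exact absurd hwT ha.2.2
          · exact ⟨s, hs, Or.inl hR⟩
        · obtain ⟨a, ha, hac, s, hs, hR⟩ := hP T hTP' hT c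
          rw [Finset.mem_sdiff] at ha
          by_cases haS : a ∈ S
          swap
          · exact ⟨a, by simp [ha, haS], hac, s, hs, Or.inl hR⟩
          by_cases hwc : w = c
          swap
          · exact ⟨w, by simp [hPU hwP, hwS, hwT], hwc, s, hs, Or.inr ⟨rfl, a, haS, hR⟩⟩
          subst hwc
          by_contra hcon
          have hmem : S ∪ T ∈ P.powerset.filter fun S => S.Nonempty ∧ w ∉ S ∧
              ∀ a ∈ U \ S, (∃ s ∈ S, R a s) → a = z ∨ a = w := by
            refine Finset.mem_filter.2 ⟨Finset.mem_powerset.2 hST,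
              hSne.mono Finset.subset_union_left, by simp [hwS, hwT], ?_⟩
            rintro b hb ⟨s', hs', hR'⟩
            simp only [Finset.mem_sdiff, Finset.mem_union, not_or] at hb hs'
            rcases hs' with hs' | hs'
            · exact hSpred b (by simp [hb]) ⟨s', hs', hR'⟩
            · refine Or.inr ?_
              by_contra hbw
              exact hcon ⟨b, by simp [hb], hbw, s', hs', Or.inl hR'⟩
          refine absurd (hmax _ hmem) (not_le.2 (Finset.card_lt_card
            ⟨Finset.subset_union_left, fun h => hTS s hs (h (Finset.mem_union_right _ hs))⟩))) rfl
    exact IsLowHigh.glue hSU hPU (hPU hwP) hwS hzU hzS hzw'.symm hyi hyo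
  · push Not at hbad
    obtain ⟨z', hz', hz'z, w', hw', hR'⟩ := hP {w} (by simpa using hwP) (by simp) z
    rw [Finset.mem_singleton] at hw'
    subst hw'
    simp only [Finset.mem_sdiff, Finset.mem_singleton] at hz'
    obtain ⟨yo, hyo⟩ := ih (P \ {w'}).card
      (hn ▸ Finset.card_lt_card ⟨Finset.sdiff_subset, fun h => by
        simpa using h hwP⟩)
      (fun a b => R a b ∨ (a = z ∧ ∃ s ∈ ({w'} : Finset α), R s b)) (U \ {w'}) (P \ {w'})
      (Finset.sdiff_subset_sdiff hPU subset_rfl) (fun T hTP hT c => by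
        have hTP' : T ⊆ P := hTP.trans Finset.sdiff_subset
        have hwT : w' ∉ T := fun h => by simpa using hTP h
        have hzT : z ∉ T := fun h => hzP (hTP' h)
        obtain ⟨a, ha, ⟨s, hs, hR⟩, haz, haw⟩ := hbad T hTP' hT hwT
        rw [Finset.mem_sdiff] at ha
        by_cases hac : a = c
        swap
        · exact ⟨a, by simp [ha, haw], hac, s, hs, Or.inl hR⟩
        obtain ⟨b, hb, hbc, s', hs', hRb⟩ := hP T hTP' hT c
        rw [Finset.mem_sdiff] at hb
        by_cases hbw : b = w'
        · subst hbw
          exact ⟨z, by simp [hzU, hzw', hzT], fun h => haz (hac.trans h.symm), s', hs',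
            Or.inr ⟨rfl, b, by simp, hRb⟩⟩
        · exact ⟨b, by simp [hb, hbw], hbc, s', hs', Or.inl hRb⟩) rfl
    refine IsLowHigh.glue (S := {w'}) (t := z) (z := z') (by simpa using hPU hwP) hPU hzU
      (by simpa using hzw') hz'.1 (by simpa using hz'.2) hz'z.symm
      (yi := fun a => if a = z then 0 else if a = w' then 1 else 2) ⟨?_, ?_⟩ hyo
    · intro a ha b hb
      simp only [Finset.coe_insert, Finset.coe_singleton, Set.mem_insert_iff,
        Set.mem_singleton_iff] at ha hb
      rcases ha with ha | ha | ha <;> rcases hb with hb | hb | hb <;>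
        simp [ha, hb, hzw'.symm, hz'z, hz'.2]
    · intro a ha
      rw [Finset.mem_singleton] at ha
      subst ha
      exact ⟨⟨z, by simp, hzw, by simp [hzw'.symm]⟩, z', by simp, hR', by
        simp [hzw'.symm, hz'z, hz'.2]⟩

namespace RootedRows

open MvPolynomial

variable {W ε : Type*}

/-- `ParentRel s f a b`: the edge `f b` chosen at `b` starts at `a`; `none` is the root. -/
def ParentRel (s : ε → Option W) (f : W → ε) (a b : W) : Prop := s (f b) = some a

variable [DecidableEq W]

/-- Multiply the variables labelled `w` by an extra variable. -/
noncomputable def scaleRow (τ : ε → W) (w : W) :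
    MvPolynomial ε ℚ →ₐ[ℚ] Polynomial (MvPolynomial ε ℚ) :=
  aeval fun e => if τ e = w then Polynomial.C (X e) * Polynomial.X else Polynomial.C (X e)

theorem eval_one_scaleRow (τ : ε → W) (w : W) (p : MvPolynomial ε ℚ) :
    (scaleRow τ w p).eval 1 = p := by
  induction p using MvPolynomial.induction_on with
  | C a => simp [scaleRow, MvPolynomial.algebraMap_eq, Polynomial.algebraMap_apply]
  | add p q hp hq => rw [map_add, Polynomial.eval_add, hp, hq]
  | mul_X p e hp =>
    rw [map_mul, Polynomial.eval_mul, hp, scaleRow, aeval_X]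
    split_ifs <;> simp

theorem eval_zero_scaleRow (τ : ε → W) (w : W) (p : MvPolynomial ε ℚ) :
    (scaleRow τ w p).eval 0 = bind₁ (fun e => if τ e = w then 0 else X e) p := by
  induction p using MvPolynomial.induction_on with
  | C a => simp [scaleRow, MvPolynomial.algebraMap_eq, Polynomial.algebraMap_apply]
  | add p q hp hq => rw [map_add, Polynomial.eval_add, hp, hq, map_add]
  | mul_X p e hp =>
    rw [map_mul, Polynomial.eval_mul, hp, map_mul, bind₁_X_right, scaleRow, aeval_X]
    split_ifs <;> simp

theorem ne_of_mem_vars_of_natDegree_scaleRow {τ : ε → W} {w : W} {p : MvPolynomial ε ℚ}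
    (h : (scaleRow τ w p).natDegree = 0) {e : ε} (he : e ∈ p.vars) : τ e ≠ w := by
  rw [Polynomial.natDegree_eq_zero] at h
  obtain ⟨q, hq⟩ := h
  have h1 := eval_one_scaleRow τ w p
  have h0 := eval_zero_scaleRow τ w p
  rw [← hq, Polynomial.eval_C] at h1 h0
  rw [← h1, h0] at he
  obtain ⟨i, -, hi⟩ := mem_vars_bind₁ _ _ he
  split_ifs at hi with hw
  · simp at hi
  · rw [vars_X, Finset.mem_singleton] at hi
    exact hi ▸ hw

variable [Fintype W]

open Classical in
/-- The generating polynomial of the arborescences rooted at `none`, encoded as acyclic choices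
of an incoming edge `f w ∈ E w` for every vertex `w`. -/
noncomputable def arbPoly (E : W → Finset ε) (s : ε → Option W) : MvPolynomial ε ℚ :=
  ∑ f ∈ (Fintype.piFinset E).filter (fun f => WellFounded (ParentRel s f)), ∏ w, X (f w)

/-- The row of the reduced Laplacian contributed by the edge `e` entering `w`. -/
def edgeRow (R : Type*) [Ring R] (s : ε → Option W) (w : W) (e : ε) (j : W) : R :=
  (if w = j then 1 else 0) - if s e = some j then 1 else 0

theorem sum_edgeRow_mul {R : Type*} [CommRing R] (s : ε → Option W) (w : W) (e : ε) (y : W → R) :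
    ∑ j, edgeRow R s w e j * y j = y w - (s e).elim 0 y := by
  simp only [edgeRow, sub_mul, Finset.sum_sub_distrib, ite_mul, one_mul, zero_mul]
  cases h : s e <;> simp

theorem det_edgeRow_of_wellFounded {R : Type*} [CommRing R] (s : ε → Option W) (f : W → ε)
    (hf : WellFounded (ParentRel s f)) :
    (Matrix.of fun w => edgeRow R s w (f w)).det = 1 := by
  rw [Matrix.det_apply, Finset.sum_eq_single 1]
  · have h : ∀ w, s (f w) ≠ some w := fun w h =>
      hf.asymmetric (a := w) (b := w) h h
    simp [edgeRow, h]
  · intro σ _ hσ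
    by_contra hne
    apply hσ
    have hprod : ∏ i, (Matrix.of fun w => edgeRow R s w (f w)) (σ i) i ≠ 0 :=
      fun h => hne (by rw [h, smul_zero])
    have hstep : ∀ i, σ i = i ∨ s (f (σ i)) = some i := by
      intro i
      by_contra hcon
      push Not at hcon
      exact hprod (Finset.prod_eq_zero (Finset.mem_univ i) (by simp [edgeRow, hcon.1, hcon.2]))
    have key : ∀ w, σ⁻¹ w = w := by
      intro w
      induction w using hf.induction with
      | _ w ih =>
      rcases hstep (σ⁻¹ w) with h | h
      · simpa using h.symm
      · exact σ⁻¹.injective (ih (σ⁻¹ w) (by simpa [ParentRel] using h))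
    ext w
    simpa using congrArg σ (key w).symm
  · simp

theorem det_edgeRow_of_not_wellFounded {R : Type*} [CommRing R] [IsDomain R]
    (s : ε → Option W) (f : W → ε) (hf : ¬ WellFounded (ParentRel s f)) :
    (Matrix.of fun w => edgeRow R s w (f w)).det = 0 := by
  classical
  obtain ⟨w₀, hw₀⟩ : ∃ w, ¬ Acc (ParentRel s f) w := by
    by_contra h
    push Not at h
    exact hf ⟨h⟩
  rw [← Matrix.exists_mulVec_eq_zero_iff]
  refine ⟨fun w => if Acc (ParentRel s f) w then 0 else 1, ?_, ?_⟩
  · intro h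
    simpa [hw₀] using congrFun h w₀
  · funext w
    change ∑ j, edgeRow R s w (f w) j * _ = 0
    rw [sum_edgeRow_mul]
    cases h : s (f w) with
    | none =>
      have : Acc (ParentRel s f) w := ⟨w, fun b hb => by simp [ParentRel, h] at hb⟩
      simp [this]
    | some a =>
      have : Acc (ParentRel s f) w ↔ Acc (ParentRel s f) a := by
        refine ⟨fun hw => hw.inv h, fun ha => ⟨w, fun b hb => ?_⟩⟩
        rw [ParentRel, h, Option.some_inj] at hb
        exact hb ▸ ha
      simp [this]

/-- The matrix-tree theorem for arborescences rooted at `none`. -/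
theorem aeval_arbPoly {R : Type*} [CommRing R] [IsDomain R] [Algebra ℚ R]
    (E : W → Finset ε) (s : ε → Option W) (x : ε → R) :
    aeval x (arbPoly E s) =
      (Matrix.of fun w j => ∑ e ∈ E w, x e * edgeRow R s w e j).det := by
  classical
  have hrows : (Matrix.of fun w j => ∑ e ∈ E w, x e * edgeRow R s w e j).det =
      ∑ f ∈ Fintype.piFinset E, (Matrix.of fun w j => x (f w) * edgeRow R s w (f w) j).det := by
    have := Matrix.detRowAlternating.toMultilinearMap.map_sum_finset
      (fun w e => fun j => x e * edgeRow R s w e j) E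
    refine Eq.trans ?_ this
    change Matrix.det _ = Matrix.det _
    congr 1
    ext w j
    simp
  have hdet : ∀ f : W → ε, (Matrix.of fun w j => x (f w) * edgeRow R s w (f w) j).det =
      if WellFounded (ParentRel s f) then ∏ w, x (f w) else 0 := by
    intro f
    have := Matrix.det_mul_column (fun w => x (f w)) (Matrix.of fun w => edgeRow R s w (f w))
    simp only [Matrix.of_apply] at this
    rw [this]
    split_ifs with h
    · rw [det_edgeRow_of_wellFounded s f h, mul_one]
    · rw [det_edgeRow_of_not_wellFounded s f h, mul_zero]
  rw [hrows, arbPoly, map_sum, Finset.sum_filter]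
  refine Finset.sum_congr rfl fun f _ => ?_
  rw [hdet]
  split_ifs <;> simp

theorem eval_arbPoly_pos (E : W → Finset ε) (s : ε → Option W) (h : arbPoly E s ≠ 0)
    (x : ε → ℚ) (hx : ∀ e, 0 < x e) : 0 < eval x (arbPoly E s) := by
  classical
  rw [arbPoly, map_sum]
  refine Finset.sum_pos (fun f _ => ?_) (Finset.nonempty_of_sum_ne_zero h)
  rw [map_prod]
  exact Finset.prod_pos fun w _ => by simpa using hx (f w)

theorem scaleRow_arbPoly {E : W → Finset ε} {s : ε → Option W} {τ : ε → W}
    (hτ : ∀ w, ∀ e ∈ E w, τ e = w) (w : W) :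
    scaleRow τ w (arbPoly E s) = Polynomial.C (arbPoly E s) * Polynomial.X := by
  classical
  rw [arbPoly, map_sum, map_sum, Finset.sum_mul]
  refine Finset.sum_congr rfl fun f hf => ?_
  rw [Finset.mem_filter, Fintype.mem_piFinset] at hf
  have : ∀ v, scaleRow τ w (X (f v)) =
      Polynomial.C (X (f v)) * if v = w then Polynomial.X else 1 := by
    intro v
    rw [scaleRow, aeval_X, hτ v _ (hf.1 v)]
    split_ifs <;> simp
  rw [map_prod, map_prod, Finset.prod_congr rfl fun v _ => this v, Finset.prod_mul_distrib]
  simp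

/-- Every row of variables occurs in at most one of two factors of `arbPoly`. -/
theorem notMem_vars_or_of_arbPoly_eq_mul {E : W → Finset ε} {s : ε → Option W} {τ : ε → W}
    (hτ : ∀ w, ∀ e ∈ E w, τ e = w) {P Q : MvPolynomial ε ℚ} (h0 : arbPoly E s ≠ 0)
    (h : arbPoly E s = P * Q) (w : W) :
    (∀ e ∈ P.vars, τ e ≠ w) ∨ ∀ e ∈ Q.vars, τ e ≠ w := by
  have hs := scaleRow_arbPoly (s := s) hτ w
  rw [h, map_mul, ← h] at hs
  have hne : Polynomial.C (arbPoly E s) * Polynomial.X ≠ 0 :=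
    mul_ne_zero (by simpa using h0) Polynomial.X_ne_zero
  have hdeg := congrArg Polynomial.natDegree hs
  rw [Polynomial.natDegree_mul (left_ne_zero_of_mul (hs ▸ hne))
    (right_ne_zero_of_mul (hs ▸ hne)), Polynomial.natDegree_C_mul_X _ h0] at hdeg
  rcases Nat.eq_zero_or_pos (scaleRow τ w P).natDegree with h' | h'
  · exact Or.inl fun e he => ne_of_mem_vars_of_natDegree_scaleRow h' he
  · exact Or.inr fun e he => ne_of_mem_vars_of_natDegree_scaleRow (by omega) he

theorem exists_pos_sum_mul_eq_zero (A : Finset ε) (d : ε → ℚ) (hpos : ∃ e ∈ A, 0 < d e)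
    (hneg : ∃ e ∈ A, d e < 0) : ∃ x : ε → ℚ, (∀ e, 0 < x e) ∧ ∑ e ∈ A, x e * d e = 0 := by
  classical
  obtain ⟨a, ha, hda⟩ := hpos
  obtain ⟨b, hb, hdb⟩ := hneg
  obtain ⟨c, hc, hdc, hsign⟩ : ∃ c ∈ A, d c ≠ 0 ∧ 0 ≤ -(∑ e ∈ A, d e) / d c := by
    rcases le_total 0 (∑ e ∈ A, d e) with h | h
    · exact ⟨b, hb, hdb.ne, div_nonneg_of_nonpos (by linarith) hdb.le⟩
    · exact ⟨a, ha, hda.ne', div_nonneg (by linarith) hda.le⟩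
  refine ⟨fun e => 1 + if e = c then -(∑ e ∈ A, d e) / d c else 0, fun e => ?_, ?_⟩
  · dsimp only
    split_ifs <;> linarith
  · simp only [add_mul, one_mul, Finset.sum_add_distrib, ite_mul, zero_mul, Finset.sum_ite_eq',
      hc, if_true]
    field_simp
    ring

/-- Potentials (variables on the right) extended by `0` at the root. -/
noncomputable def potential : Option W → MvPolynomial (ε ⊕ W) ℚ :=
  fun a => a.elim 0 fun w => X (Sum.inr w)

open Classical in
/-- Generic edge weights for which the generic potential is harmonic: outside of the reference
edges `ρ w` they are free up to a factor. -/
noncomputable def harmonicWeight (E : W → Finset ε) (s : ε → Option W) (τ : ε → W) (ρ : W → ε)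
    (e : ε) : MvPolynomial (ε ⊕ W) ℚ :=
  if e = ρ (τ e) then
    -∑ e' ∈ (E (τ e)).erase e, X (Sum.inl e') * (potential (some (τ e)) - potential (s e'))
  else X (Sum.inl e) * (potential (some (τ e)) - potential (s (ρ (τ e))))

theorem aeval_harmonicWeight_arbPoly [Nonempty W] {E : W → Finset ε} {s : ε → Option W}
    {τ : ε → W} (hτ : ∀ w, ∀ e ∈ E w, τ e = w) {ρ : W → ε} (hρ : ∀ w, ρ w ∈ E w) :
    aeval (harmonicWeight E s τ ρ) (arbPoly E s) = 0 := by
  classical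
  rw [aeval_arbPoly, ← Matrix.exists_mulVec_eq_zero_iff]
  refine ⟨fun w => X (Sum.inr w), fun h => ?_, ?_⟩
  · obtain ⟨w⟩ := ‹Nonempty W›
    exact X_ne_zero _ (congrFun h w)
  · funext w
    change ∑ j, (∑ e ∈ E w, harmonicWeight E s τ ρ e * edgeRow _ s w e j) * X (Sum.inr j) = 0
    have : ∀ e, ∑ j, edgeRow (MvPolynomial (ε ⊕ W) ℚ) s w e j * X (Sum.inr j) =
        potential (some w) - potential (s e) := fun e =>
      sum_edgeRow_mul s w e fun j => (X (Sum.inr j) : MvPolynomial (ε ⊕ W) ℚ)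
    simp only [Finset.sum_mul, mul_assoc]
    rw [Finset.sum_comm]
    simp only [← Finset.mul_sum, this]
    rw [← Finset.add_sum_erase _ _ (hρ w)]
    have hρw : τ (ρ w) = w := hτ w _ (hρ w)
    rw [harmonicWeight, if_pos (by rw [hρw]), hρw, neg_mul, Finset.sum_mul,
      neg_add_eq_zero]
    refine Finset.sum_congr rfl fun e he => ?_
    rw [Finset.mem_erase] at he
    rw [harmonicWeight, hτ w e he.2, if_neg he.1]
    ring

/-- A factor involving only a proper subset of the rows does not vanish identically on the
harmonic weights. -/
theorem aeval_harmonicWeight_ne_zero {E : W → Finset ε} {s : ε → Option W}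
    {τ : ε → W} (hτ : ∀ w, ∀ e ∈ E w, τ e = w) {ρ : W → ε} (hρ : ∀ w, ρ w ∈ E w)
    (hρs : ∀ w, s (ρ w) ≠ some w)
    (hcond : ∀ S : Finset W, S.Nonempty → S ≠ Finset.univ → ∀ c : Option W,
      ∃ w ∈ S, ∃ e ∈ E w, s e ≠ c ∧ ∀ w' ∈ S, s e ≠ some w')
    (h0 : arbPoly E s ≠ 0) {P Q : MvPolynomial ε ℚ} (h : arbPoly E s = P * Q) {v : W}
    (hv : ∀ e ∈ P.vars, τ e ≠ v) : aeval (harmonicWeight E s τ ρ) P ≠ 0 := by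
  classical
  obtain ⟨y', hyinj, hy'⟩ := exists_isLowHigh
    (fun a b : Option W => ∃ w, b = some w ∧ ∃ e ∈ E w, s e = a) Finset.univ
    ((Finset.univ.erase v).map ⟨some, Option.some_injective W⟩) (Finset.subset_univ _) (by
      intro S hS hne c
      obtain ⟨w, hw, e, he, hec, hes⟩ := hcond (Finset.univ.filter fun w => some w ∈ S) (by
          obtain ⟨a, ha⟩ := hne
          obtain ⟨w, -, rfl⟩ := Finset.mem_map.1 (hS ha)
          exact ⟨w, by simpa using ha⟩) (by
          intro huniv
          have hvS : some v ∈ S := by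
            have := Finset.mem_univ v
            rw [← huniv] at this
            simpa using this
          simpa using hS hvS) c
      refine ⟨s e, ?_, hec, some w, by simpa using hw, w, rfl, e, he, rfl⟩
      rw [Finset.mem_sdiff]
      refine ⟨Finset.mem_univ _, fun hmem => ?_⟩
      obtain ⟨w', -, hw'⟩ := Finset.mem_map.1 (hS hmem)
      have hw'' : some w' = s e := hw'
      exact hes w' (by simpa [hw''] using hmem) hw''.symm)
  set y : Option W → ℚ := fun a => y' a - y' none with hy
  have hinj : ∀ a b, y a = y b → a = b := fun a b hab =>
    hyinj (by simp) (by simp) (sub_left_injective hab)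
  have hx : ∀ w, ∃ x : ε → ℚ, (∀ e, 0 < x e) ∧
      (w ≠ v → ∑ e ∈ E w, x e * (y (some w) - y (s e)) = 0) := by
    intro w
    by_cases hw : w = v
    · exact ⟨fun _ => 1, fun _ => one_pos, fun h => absurd hw h⟩
    · obtain ⟨⟨a, -, ⟨w₁, hw₁, e₁, he₁, rfl⟩, hlt₁⟩, b, -, ⟨w₂, hw₂, e₂, he₂, rfl⟩, hlt₂⟩ :=
        hy' (some w) (by simpa using hw)
      rw [Option.some_inj] at hw₁ hw₂
      subst hw₁ hw₂
      obtain ⟨x, hx, hsum⟩ := exists_pos_sum_mul_eq_zero (E w)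
        (fun e => y (some w) - y (s e)) ⟨e₁, he₁, by simp only [hy]; linarith⟩
        ⟨e₂, he₂, by simp only [hy]; linarith⟩
      exact ⟨x, hx, fun _ => hsum⟩
  choose x hxpos hxsum using hx
  have hden : ∀ w, y (some w) - y (s (ρ w)) ≠ 0 := fun w h =>
    hρs w (hinj _ _ (sub_eq_zero.1 h)).symm
  intro hzero
  have hP : eval (fun e => x (τ e) e) P ≠ 0 := by
    have := (eval_arbPoly_pos E s h0 (fun e => x (τ e) e) fun e => hxpos _ e).ne'
    rw [h, map_mul] at this
    exact left_ne_zero_of_mul this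
  set pt : ε ⊕ W → ℚ := Sum.elim
    (fun e => x (τ e) e / (y (some (τ e)) - y (s (ρ (τ e))))) (fun w => y (some w)) with hpt
  have hpot : ∀ a : Option W, eval pt (potential (ε := ε) a) = y a := by
    rintro (_ | w) <;> simp [potential, hpt, hy]
  have hweight : ∀ e, τ e ≠ v → eval pt (harmonicWeight E s τ ρ e) = x (τ e) e := by
    intro e he
    rw [harmonicWeight]
    split_ifs with hρe
    · have hmem : e ∈ E (τ e) := by
        have := hρ (τ e)
        rwa [← hρe] at this
      have hs := hxsum (τ e) he
      rw [← Finset.add_sum_erase _ _ hmem] at hs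
      have hd := hden (τ e)
      rw [← hρe] at hd
      rw [map_neg, map_sum]
      have : ∀ e' ∈ (E (τ e)).erase e, eval pt (X (Sum.inl e') *
          (potential (some (τ e)) - potential (s e'))) =
          x (τ e) e' * (y (some (τ e)) - y (s e')) / (y (some (τ e)) - y (s e)) := by
        intro e' he'
        have hτ' := hτ _ e' (Finset.mem_of_mem_erase he')
        rw [map_mul, map_sub, hpot, hpot, eval_X]
        simp only [hpt, Sum.elim_inl, hτ']
        rw [← hρe]
        ring
      rw [Finset.sum_congr rfl this, ← Finset.sum_div, ← neg_div, div_eq_iff hd]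
      linarith
    · rw [map_mul, map_sub, hpot, hpot, eval_X]
      simp only [hpt, Sum.elim_inl]
      exact div_mul_cancel₀ _ (hden _)
  apply hP
  have hcomp : eval (fun e => x (τ e) e) P =
      ((eval pt).comp (aeval (harmonicWeight E s τ ρ)).toRingHom) P :=
    hom_congr_vars (RingHom.ext_rat _ _)
      (fun e he _ => by simp [hweight e (hv e he)]) rfl
  rw [hcomp]
  change eval pt (aeval (harmonicWeight E s τ ρ) P) = 0
  rw [hzero, map_zero]

/-- If every nonempty proper set of non-root vertices has at least two predecessors outside of
it, the arborescence polynomial has no nontrivial factorization. -/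
theorem eq_C_or_eq_C_of_arbPoly_eq_mul [Nonempty W] {E : W → Finset ε} {s : ε → Option W}
    {τ : ε → W} (hτ : ∀ w, ∀ e ∈ E w, τ e = w)
    (hcond : ∀ S : Finset W, S.Nonempty → S ≠ Finset.univ → ∀ c : Option W,
      ∃ w ∈ S, ∃ e ∈ E w, s e ≠ c ∧ ∀ w' ∈ S, s e ≠ some w')
    {P Q : MvPolynomial ε ℚ} (h : arbPoly E s = P * Q) :
    (∃ c, P = C c) ∨ ∃ c, Q = C c := by
  classical
  by_cases h0 : arbPoly E s = 0
  · rw [h0, eq_comm, mul_eq_zero] at h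
    exact h.imp (fun h => ⟨0, by simpa using h⟩) (fun h => ⟨0, by simpa using h⟩)
  by_contra hcon
  push Not at hcon
  have hvars : ∀ p : MvPolynomial ε ℚ, (∀ c, p ≠ C c) → ∃ e, e ∈ p.vars := by
    intro p hp
    by_contra hne
    push Not at hne
    exact hp _ (vars_eq_empty_iff_eq_C.1 (Finset.eq_empty_of_forall_notMem hne))
  obtain ⟨eP, heP⟩ := hvars P hcon.1
  obtain ⟨eQ, heQ⟩ := hvars Q hcon.2
  have hvQ := (notMem_vars_or_of_arbPoly_eq_mul hτ h0 h (τ eP)).resolve_left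
    fun h => h eP heP rfl
  have hvP := (notMem_vars_or_of_arbPoly_eq_mul hτ h0 h (τ eQ)).resolve_right
    fun h => h eQ heQ rfl
  have hne : τ eP ≠ τ eQ := hvP eP heP
  have hρ : ∀ w, ∃ e ∈ E w, s e ≠ some w := by
    intro w
    obtain ⟨w', hw', e, he, -, hes⟩ := hcond {w} (by simp) (by
      intro huniv
      have h1 := Finset.mem_univ (τ eP)
      have h2 := Finset.mem_univ (τ eQ)
      rw [← huniv, Finset.mem_singleton] at h1 h2
      exact hne (h1.trans h2.symm)) none
    rw [Finset.mem_singleton] at hw'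
    subst hw'
    exact ⟨e, he, hes _ (by simp)⟩
  choose ρ hρE hρs using hρ
  have hz := aeval_harmonicWeight_arbPoly (s := s) hτ hρE
  rw [h, map_mul, mul_eq_zero] at hz
  rcases hz with hz | hz
  · exact aeval_harmonicWeight_ne_zero hτ hρE hρs hcond h0 h hvP hz
  · exact aeval_harmonicWeight_ne_zero hτ hρE hρs hcond h0 (h.trans (mul_comm _ _)) hvQ hz

end RootedRows

namespace MultiDigraph

variable {V : Type*} {ε : Type*} {G : MultiDigraph V ε} {v a b c w x : V}

/-- There is a walk from `v` to `w` avoiding the vertex `c`. -/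
def AvoidReaches (G : MultiDigraph V ε) (v c w : V) : Prop :=
  v ≠ c ∧ Relation.ReflTransGen (fun a b => G.Step G.edges a b ∧ b ≠ c) v w

theorem AvoidReaches.step (h : G.AvoidReaches v c a) (hs : G.Step G.edges a b) (hb : b ≠ c) :
    G.AvoidReaches v c b :=
  ⟨h.1, h.2.tail ⟨hs, hb⟩⟩

theorem AvoidReaches.ne (h : G.AvoidReaches v c a) : a ≠ c := by
  rcases Relation.ReflTransGen.cases_tail h.2 with rfl | ⟨_, _, h'⟩
  · exact h.1
  · exact h'.2

theorem IsWalk.append {A : Finset ε} {p : List ε} (hp : G.IsWalk A p v a) {e : ε} (he : e ∈ A)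
    (hs : G.src e = a) : G.IsWalk A (p ++ [e]) v (G.tgt e) := by
  induction p generalizing v with
  | nil =>
    obtain rfl : v = a := hp
    exact ⟨he, hs, rfl⟩
  | cons f p ih => exact ⟨hp.1, hp.2.1, ih hp.2.2⟩

theorem IsWalk.reaches_avoiding {p : List ε} (hp : G.IsWalk G.edges p v w)
    (hc : ∀ x ∈ p.map G.tgt, x ≠ c) :
    Relation.ReflTransGen (fun a b => G.Step G.edges a b ∧ b ≠ c) v w := by
  induction p generalizing v with
  | nil =>
    obtain rfl : v = w := hp
    exact .refl
  | cons f p ih =>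
    refine .head ⟨⟨f, hp.1, hp.2.1, rfl⟩, hc _ (by simp)⟩ (ih hp.2.2 fun x hx => hc x ?_)
    simp only [List.map_cons, List.mem_cons]
    exact Or.inr hx

theorem IsWalk.exists_initial_walk {A : Finset ε} {p : List ε} (hp : G.IsWalk A p v w)
    (hx : x ∈ v :: p.map G.tgt) : ∃ q, q <+: p ∧ G.IsWalk A q v x := by
  induction p generalizing v with
  | nil =>
    obtain rfl : x = v := by simpa using hx
    exact ⟨[], List.prefix_rfl, rfl⟩
  | cons f p ih =>
    rcases List.mem_cons.1 hx with rfl | hx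
    · exact ⟨[], ⟨_, rfl⟩, rfl⟩
    · obtain ⟨q, hq, hw⟩ := ih hp.2.2 hx
      exact ⟨f :: q, List.cons_prefix_cons.2 ⟨rfl, hq⟩, hp.1, hp.2.1, hw⟩

theorem AvoidReaches.exists_isPath (h : G.AvoidReaches v c w) :
    ∃ p, G.IsPath G.edges p v w ∧ c ∉ v :: p.map G.tgt := by
  obtain ⟨hv, h⟩ := h
  induction h with
  | refl => exact ⟨[], ⟨rfl, by simp⟩, by simpa using hv.symm⟩
  | @tail a b _ hs ih =>
    obtain ⟨p, ⟨hwalk, hnodup⟩, hc⟩ := ih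
    obtain ⟨⟨e, he, hsrc, rfl⟩, hb⟩ := hs
    by_cases hmem : G.tgt e ∈ v :: p.map G.tgt
    · obtain ⟨q, hq, hqw⟩ := hwalk.exists_initial_walk hmem
      have hsub : (v :: q.map G.tgt).Sublist (v :: p.map G.tgt) :=
        (hq.sublist.map _).cons_cons v
      exact ⟨q, ⟨hqw, hnodup.sublist hsub⟩, fun h => hc (hsub.subset h)⟩
    · refine ⟨p ++ [e], ⟨hwalk.append he hsrc, ?_⟩, ?_⟩
      · rw [List.map_append, ← List.cons_append]
        refine List.Nodup.append hnodup (by simp) ?_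
        simpa using hmem
      · rw [List.map_append, ← List.cons_append, List.mem_append, not_or]
        exact ⟨hc, by simpa using hb.symm⟩

theorem not_dominates_iff : ¬ G.Dominates v c w ↔ G.AvoidReaches v c w := by
  constructor
  · intro h
    rw [Dominates] at h
    push Not at h
    obtain ⟨p, hp, hc⟩ := h
    exact ⟨fun h => hc (by simp [h]), hp.1.reaches_avoiding fun x hx h =>
      hc (List.mem_cons_of_mem _ (h ▸ hx))⟩
  · rintro h hd
    obtain ⟨p, hp, hc⟩ := h.exists_isPath
    exact hc (hd p hp)

theorem dominates_iff : G.Dominates v c w ↔ ¬ G.AvoidReaches v c w := by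
  rw [← not_dominates_iff, not_not]

theorem dominates_self : G.Dominates v a a :=
  dominates_iff.2 fun h => h.ne rfl

theorem Dominates.trans (hab : G.Dominates v a b) (hbc : G.Dominates v b c) :
    G.Dominates v a c := by
  rw [dominates_iff] at *
  rintro ⟨hv, hr⟩
  have key : G.AvoidReaches v b c := by
    induction hr with
    | refl => exact ⟨fun h => hab (h ▸ ⟨hv, .refl⟩), .refl⟩
    | @tail x y hx hs ih => exact (ih fun h => hbc (h.step hs.1 (by
        rintro rfl
        exact hab (AvoidReaches.step ⟨hv, hx⟩ hs.1 hs.2)))).step hs.1 (by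
        rintro rfl
        exact hab (AvoidReaches.step ⟨hv, hx⟩ hs.1 hs.2))
  exact hbc key

theorem Dominates.antisymm (hab : G.Dominates v a b) (hba : G.Dominates v b a)
    (ha : G.Reaches G.edges v a) : a = b := by
  by_contra hne
  rw [dominates_iff] at hab hba
  have key : ∀ x, G.Reaches G.edges v x → G.AvoidReaches v a x ∧ G.AvoidReaches v b x := by
    intro x hx
    induction hx with
    | refl =>
      refine ⟨⟨?_, .refl⟩, ⟨?_, .refl⟩⟩
      · rintro rfl
        exact hba ⟨hne, .refl⟩
      · rintro rfl
        exact hab ⟨Ne.symm hne, .refl⟩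
    | @tail x y _ hs ih =>
      refine ⟨ih.1.step hs ?_, ih.2.step hs ?_⟩
      · rintro rfl
        exact hba (ih.2.step hs hne)
      · rintro rfl
        exact hab (ih.1.step hs (Ne.symm hne))
  exact (key a ha).1.ne rfl

theorem Dominates.total (ha : G.Dominates v a w) (hb : G.Dominates v b w)
    (hw : G.Reaches G.edges v w) : G.Dominates v a b ∨ G.Dominates v b a := by
  rw [dominates_iff] at ha hb
  by_contra hcon
  simp only [dominates_iff, not_or, not_not] at hcon
  obtain ⟨hab, hba⟩ := hcon
  have key : ∀ x, G.Reaches G.edges v x → G.AvoidReaches v a x ∨ G.AvoidReaches v b x := by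
    intro x hx
    induction hx with
    | refl => exact Or.inl ⟨hab.1, .refl⟩
    | @tail x y _ hs ih =>
      rcases ih with ih | ih
      · by_cases hy : y = a
        · exact Or.inr (hy ▸ hba)
        · exact Or.inl (ih.step hs hy)
      · by_cases hy : y = b
        · exact Or.inl (hy ▸ hab)
        · exact Or.inr (ih.step hs hy)
  exact (key w hw).elim ha hb

theorem Dominates.of_step (hz : G.Dominates v c b) (hs : G.Step G.edges a b) (hbc : b ≠ c) :
    G.Dominates v c a := by
  rw [dominates_iff] at *
  exact fun h => hz (h.step hs hbc)

/-- Below a strict dominator `u` of `a` there is a vertex immediately dominated by `u` which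
dominates `a`. -/
theorem RootedAt.exists_immDominates (hroot : G.RootedAt v) {u : V} (ha : a ∈ G.verts)
    (hua : G.Dominates v u a) (hne : u ≠ a) :
    ∃ z ∈ G.verts, G.ImmDominates v u z ∧ G.Dominates v z a := by
  classical
  obtain ⟨z, hz, hmax⟩ := (G.verts.filter fun x =>
    G.Dominates v x a ∧ x ≠ u ∧ G.Dominates v u x).exists_max_image
      (fun x => (G.domSet v x).card) ⟨a, by simp [ha, dominates_self, hne.symm, hua]⟩
  rw [Finset.mem_filter] at hz
  obtain ⟨hzV, hza, hzu, huz⟩ := hz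
  refine ⟨z, hzV, ⟨hzu.symm, huz, fun x hx hxu hxz hdom => ?_⟩, hza⟩
  refine (hdom.total huz (hroot.2.2 z hzV)).resolve_right fun hux => ?_
  have hle := hmax x (by simp [hx, hdom.trans hza, hxu, hux])
  refine absurd hle (not_le.2 (Finset.card_lt_card ⟨fun y hy => ?_, fun hsub => ?_⟩))
  · rw [domSet, Finset.mem_filter] at hy ⊢
    exact ⟨hy.1, hdom.trans hy.2⟩
  · have := hsub (show x ∈ G.domSet v x by simp [domSet, hx, dominates_self])
    rw [domSet, Finset.mem_filter] at this
    exact hxz (hdom.antisymm this.2 (hroot.2.2 x hx))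

theorem ImmDominates.eq_of_dominates {u z z' : V} (hroot : G.RootedAt v)
    (hzV : z ∈ G.verts) (hz : G.ImmDominates v u z)
    (hz' : G.ImmDominates v u z') (h : G.Dominates v z z') : z = z' := by
  by_contra hne
  have h1 := hz'.2.2 z hzV hz.1.symm hne h
  exact hz.1 (h1.antisymm hz.2.1 (hroot.2.2 z hzV)).symm

theorem mem_immSet {u z : V} : z ∈ G.immSet v u ↔ z ∈ G.verts ∧ G.ImmDominates v u z := by
  simp [immSet]

theorem RootedAt.not_dominates_root (hroot : G.RootedAt v) {u z : V}
    (hz : G.ImmDominates v u z) : ¬ G.Dominates v z v := by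
  intro h
  have hzv : z = v := by
    by_contra hne
    exact dominates_iff.1 h ⟨Ne.symm hne, .refl⟩
  subst hzv
  exact hz.1 (by_contra fun hne => dominates_iff.1 hz.2.1 ⟨Ne.symm hne, .refl⟩)

/-- A nonempty set `S` of vertices immediately dominated by `u` is entered along an edge whose
source is dominated neither by an element of `S` nor by another prescribed vertex immediately
dominated by `u`. -/
theorem RootedAt.exists_edge_entering (hroot : G.RootedAt v) {u : V} {S : Finset V}
    (hS : S ⊆ G.immSet v u) (hne : S.Nonempty) (c : V) :
    ∃ e ∈ G.edges, (c ∈ G.immSet v u → ¬ G.Dominates v c (G.src e)) ∧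
      (∀ z ∈ S, ¬ G.Dominates v z (G.src e)) ∧ ∃ z ∈ S, G.Dominates v z (G.tgt e) := by
  by_contra! hcon
  obtain ⟨s, hs⟩ := hne
  have hsZ := mem_immSet.1 (hS hs)
  have hv : ∀ z ∈ S, ¬ G.Dominates v z v := fun z hz =>
    hroot.not_dominates_root (mem_immSet.1 (hS hz)).2
  by_cases hc : c ∈ G.immSet v u ∧ c ∉ S
  · have hcs : G.AvoidReaches v c s := by
      rw [← not_dominates_iff]
      intro h
      have := (mem_immSet.1 hc.1).2.eq_of_dominates hroot (mem_immSet.1 hc.1).1 hsZ.2 h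
      exact hc.2 (this ▸ hs)
    obtain ⟨hvc, hr⟩ := hcs
    have key : ∀ x, Relation.ReflTransGen (fun a b => G.Step G.edges a b ∧ b ≠ c) v x →
        ∀ z ∈ S, ¬ G.Dominates v z x := by
      intro x hx
      induction hx with
      | refl => exact hv
      | @tail x y hx hy ih =>
        obtain ⟨⟨e, he, rfl, rfl⟩, -⟩ := hy
        exact hcon e he (fun _ => not_dominates_iff.2 ⟨hvc, hx⟩) ih
    exact key s hr s hs dominates_self
  · have key : ∀ x, G.Reaches G.edges v x → ∀ z ∈ S, ¬ G.Dominates v z x := by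
      intro x hx
      induction hx with
      | refl => exact hv
      | @tail x y hx hy ih =>
        obtain ⟨e, he, rfl, rfl⟩ := hy
        exact hcon e he (fun h => ih c (by_contra fun h' => hc ⟨h, h'⟩)) ih
    exact key s (hroot.2.2 s hsZ.1) s hs dominates_self

variable [DecidableEq V]

/-- The factor digraph of the dominator-tree decomposition attached to the vertex `u`. -/
noncomputable abbrev domFactor (G : MultiDigraph V ε) (v u : V) : MultiDigraph V ε :=
  ((G.domContract v (G.immSet v u)).induce (insert u (G.immSet v u))).rootAt u

/-- In `domFactor`, a nonempty set of immediately dominated vertices is entered from outside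
along an edge whose source avoids any prescribed vertex other than `u`. -/
theorem exists_edge_domFactor (hwf : G.WellFormed) (hroot : G.RootedAt v) {u : V}
    {S : Finset V} (hS : S ⊆ G.immSet v u) (hne : S.Nonempty) (hcu : c ≠ u) :
    ∃ e ∈ (G.domFactor v u).edges, (G.domFactor v u).tgt e ∈ S ∧
      (G.domFactor v u).src e ∉ S ∧ (G.domFactor v u).src e ≠ c := by
  classical
  obtain ⟨e, he, hec, hsrc, z, hz, hztgt⟩ := hroot.exists_edge_entering hS hne c
  have hstep : G.Step G.edges (G.src e) (G.tgt e) := ⟨e, he, rfl, rfl⟩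
  have htz : G.tgt e = z := by
    by_contra h
    exact hsrc z hz (hztgt.of_step hstep h)
  obtain ⟨hzV, hzI⟩ := mem_immSet.1 (hS hz)
  have hdomz : ∀ z' ∈ G.immSet v u, G.Dominates v z' z → z' = z := fun z' hz' h =>
    (mem_immSet.1 hz').2.eq_of_dominates hroot (mem_immSet.1 hz').1 hzI h
  have hsV := (hwf e he).1
  have hua : G.Dominates v u (G.src e) :=
    Dominates.of_step (htz ▸ hzI.2.1) hstep (htz ▸ hzI.1.symm)
  have htgt : (G.domContract v (G.immSet v u)).tgt e = z := by
    refine (dif_neg ?_).trans htz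
    rintro ⟨z', hz', hd, hn⟩
    rw [htz] at hd hn
    exact hn (hdomz z' hz' hd).symm
  have hmem : e ∈ (G.domContract v (G.immSet v u)).edges := by
    refine Finset.mem_filter.2 ⟨he, ?_, ?_⟩
    · rintro z' hz' ⟨h1, h2⟩
      rw [htz] at h2
      exact hsrc z hz (hdomz z' hz' h2 ▸ h1)
    · rintro z' hz' ⟨-, h2, h3⟩
      rw [htz] at h2 h3
      exact h3 (hdomz z' hz' h2).symm
  have hsrc' : (G.domContract v (G.immSet v u)).src e = u ∨
      ((G.domContract v (G.immSet v u)).src e ∈ G.immSet v u ∧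
        G.Dominates v ((G.domContract v (G.immSet v u)).src e) (G.src e)) := by
    by_cases hex : ∃ z ∈ G.immSet v u, G.Dominates v z (G.src e) ∧ G.src e ≠ z
    · have : (G.domContract v (G.immSet v u)).src e = hex.choose := dif_pos hex
      rw [this]
      exact Or.inr ⟨hex.choose_spec.1, hex.choose_spec.2.1⟩
    · have : (G.domContract v (G.immSet v u)).src e = G.src e := dif_neg hex
      rw [this]
      by_cases hus : u = G.src e
      · exact Or.inl hus.symm
      · obtain ⟨z', hz'V, hz', hd⟩ := hroot.exists_immDominates hsV hua hus
        have hz'Z := mem_immSet.2 ⟨hz'V, hz'⟩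
        have : G.src e = z' := by
          by_contra h
          exact hex ⟨z', hz'Z, hd, h⟩
        exact Or.inr ⟨this ▸ hz'Z, dominates_self⟩
  have huZ : u ∉ G.immSet v u := fun h => (mem_immSet.1 h).2.1 rfl
  refine ⟨e, Finset.mem_filter.2 ⟨Finset.mem_filter.2 ⟨hmem, ?_, ?_⟩, ?_⟩, ?_, ?_, ?_⟩
  · rcases hsrc' with h | h
    · exact Finset.mem_insert.2 (Or.inl h)
    · exact Finset.mem_insert_of_mem h.1
  · exact htgt ▸ Finset.mem_insert_of_mem (hS hz)
  · exact fun h => hzI.1 (h.symm.trans htgt)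
  · exact htgt ▸ hz
  · intro hmemS
    rcases hsrc' with h | h
    · exact huZ (hS (h ▸ hmemS))
    · exact hsrc _ hmemS h.2
  · intro heq
    replace heq : (G.domContract v (G.immSet v u)).src e = c := heq
    rcases hsrc' with h | h
    · exact hcu (heq.symm.trans h)
    · rw [heq] at h
      exact hec h.1 h.2

end MultiDigraph

namespace MultiDigraph

open MvPolynomial RootedRows

variable {V : Type*} {ε : Type*} {H : MultiDigraph V ε} {W : Finset V}

theorem eq_C_or_eq_C_of_mul_eq_C {P Q : MvPolynomial ε ℚ} {c : ℚ} (h : P * Q = C c) :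
    (∃ c, P = C c) ∨ ∃ c, Q = C c := by
  by_cases hP : P = 0
  · exact Or.inl ⟨0, by simp [hP]⟩
  by_cases hQ : Q = 0
  · exact Or.inr ⟨0, by simp [hQ]⟩
  refine Or.inl ⟨_, totalDegree_eq_zero_iff_eq_C.1 ?_⟩
  have := totalDegree_mul_of_isDomain hP hQ
  rw [h, totalDegree_C] at this
  omega

theorem IsSCC.reaches (hW : H.IsSCC W) {x y : V} (hx : x ∈ W) (hy : y ∈ W) :
    H.Reaches H.edges x y := by
  classical
  obtain ⟨z, -, rfl⟩ := hW
  exact (Finset.mem_filter.1 hx).2.2.trans (Finset.mem_filter.1 hy).2.1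

theorem IsSCC.mem_of_reaches (hW : H.IsSCC W) {x y a : V} (hx : x ∈ W) (hy : y ∈ W)
    (ha : a ∈ H.verts) (hxa : H.Reaches H.edges x a) (hay : H.Reaches H.edges a y) : a ∈ W := by
  classical
  obtain ⟨z, -, rfl⟩ := hW
  exact Finset.mem_filter.2 ⟨ha, (Finset.mem_filter.1 hx).2.1.trans hxa,
    hay.trans (Finset.mem_filter.1 hy).2.2⟩

theorem IsSCC.subset_verts (hW : H.IsSCC W) : W ⊆ H.verts := by
  classical
  obtain ⟨z, -, rfl⟩ := hW
  exact Finset.filter_subset _ _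

theorem IsSCC.nonempty (hW : H.IsSCC W) : W.Nonempty := by
  classical
  obtain ⟨z, hz, rfl⟩ := hW
  exact ⟨z, Finset.mem_filter.2 ⟨hz, .refl, .refl⟩⟩

/-- A directed walk entering a set crosses into it along an edge. -/
theorem Reaches.exists_crossing {A : Finset ε} {S : Finset V} {x y : V} (h : H.Reaches A x y)
    (hx : x ∉ S) (hy : y ∈ S) :
    ∃ e ∈ A, H.src e ∉ S ∧ H.tgt e ∈ S ∧ H.Reaches A x (H.src e) ∧ H.Reaches A (H.tgt e) y := by
  induction h using Relation.ReflTransGen.head_induction_on with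
  | refl => exact absurd hy hx
  | @head a b hab hb ih =>
    by_cases hbS : b ∈ S
    · obtain ⟨e, he, rfl, rfl⟩ := hab
      exact ⟨e, he, hx, hbS, .refl, hb⟩
    · obtain ⟨e, he, h1, h2, h3, h4⟩ := ih hbS
      exact ⟨e, he, h1, h2, h3.head hab, h4⟩

variable [DecidableEq V]

theorem domFactor_wellFormed {G : MultiDigraph V ε} {v u : V} :
    (G.domFactor v u).WellFormed := fun _ he =>
  (Finset.mem_filter.1 (Finset.mem_filter.1 he).1).2

/-- The edges of `H` with target a given vertex of `W`. -/
def enteringEdges (H : MultiDigraph V ε) (W : Finset V) (w : W) : Finset ε :=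
  H.edges.filter fun e => H.tgt e = w

/-- The source of an edge of `Ĥ(W)`, where `none` is the auxiliary vertex. -/
def sourceIn (H : MultiDigraph V ε) (W : Finset V) (e : ε) : Option W :=
  if h : H.src e ∈ W then some ⟨H.src e, h⟩ else none

theorem sourceIn_eq_some {e : ε} {w : W} : H.sourceIn W e = some w ↔ H.src e = w := by
  unfold sourceIn
  split_ifs with h
  · simp [Subtype.ext_iff]
  · simp only [false_iff]
    exact fun h' => h (h' ▸ w.2)

theorem sourceIn_eq_none {e : ε} : H.sourceIn W e = none ↔ H.src e ∉ W := by
  unfold sourceIn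
  split_ifs with h <;> simp [h]

theorem mem_enteringEdges {w : W} {e : ε} :
    e ∈ H.enteringEdges W w ↔ e ∈ H.edges ∧ H.tgt e = w := by
  simp [enteringEdges]

theorem hatSCC_src {e : ε} : (H.hatSCC W).src e = (H.sourceIn W e).map Subtype.val := by
  by_cases h : H.src e ∈ W <;> simp [hatSCC, sourceIn, h]

theorem mem_hatSCC_verts (hent : ∃ e ∈ H.edges, H.tgt e ∈ W ∧ H.src e ∉ W) {x : Option V} :
    x ∈ (H.hatSCC W).verts ↔ x = none ∨ ∃ w : W, x = some w.1 := by
  simp only [hatSCC, if_pos hent, Finset.mem_insert, Finset.mem_image, Subtype.exists,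
    exists_prop, eq_comm (a := x)]

theorem mem_hatSCC_edges {e : ε} :
    e ∈ (H.hatSCC W).edges ↔ ∃ w, e ∈ H.enteringEdges W w := by
  simp only [hatSCC, Finset.mem_filter, mem_enteringEdges, Subtype.exists]
  constructor
  · rintro ⟨h1, h2⟩
    exact ⟨_, h2, h1, rfl⟩
  · rintro ⟨w, hw, h1, h2⟩
    exact ⟨h1, h2 ▸ hw⟩

theorem injective_of_mem_enteringEdges {f : W → ε} (hf : ∀ w, f w ∈ H.enteringEdges W w) :
    Function.Injective f := fun a b hab => Subtype.ext <| by
  rw [← (mem_enteringEdges.1 (hf a)).2, ← (mem_enteringEdges.1 (hf b)).2, hab]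

/-- A strongly connected component containing a vertex without entering edges has a constant
Kirchhoff polynomial. -/
theorem IsSCC.exists_kirchhoff_hatSCC_eq_C (hW : H.IsSCC W) {u : V} (hu : u ∈ W)
    (hin : ∀ e ∈ H.edges, H.tgt e ≠ u) : ∃ c, (H.hatSCC W).kirchhoff = C c := by
  have hedges : (H.hatSCC W).edges = ∅ := by
    refine Finset.eq_empty_of_forall_notMem fun e he => ?_
    obtain ⟨w, hw⟩ := mem_hatSCC_edges.1 he
    have hw' := mem_enteringEdges.1 hw
    rcases Relation.ReflTransGen.cases_tail (hW.reaches w.2 hu) with h | ⟨_, -, e', he', -, h⟩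
    · exact hin e hw'.1 (hw'.2.trans h.symm)
    · exact hin e' he' h
  classical
  refine ⟨∑ A ∈ (∅ : Finset ε).powerset.filter (fun A => (H.hatSCC W).IsArb A), 1, ?_⟩
  rw [kirchhoff, hedges, map_sum]
  refine Finset.sum_congr (by congr) fun A hA => ?_
  rw [Finset.subset_empty.1 (Finset.mem_powerset.1 (Finset.mem_filter.1 hA).1)]
  simp

variable [DecidableEq ε]

theorem isArbAt_none_image (hent : ∃ e ∈ H.edges, H.tgt e ∈ W ∧ H.src e ∉ W) {f : W → ε}
    (hf : ∀ w, f w ∈ H.enteringEdges W w) (hwf : WellFounded (ParentRel (H.sourceIn W) f)) :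
    (H.hatSCC W).IsArbAt (Finset.univ.image f) none := by
  have htgt : ∀ w, (H.hatSCC W).tgt (f w) = some w.1 := fun w =>
    congrArg some (mem_enteringEdges.1 (hf w)).2
  refine ⟨?_, (mem_hatSCC_verts hent).2 (Or.inl rfl), ?_, ?_, ?_, ?_⟩
  · intro e he
    obtain ⟨w, -, rfl⟩ := Finset.mem_image.1 he
    exact mem_hatSCC_edges.2 ⟨w, hf w⟩
  · intro e he
    obtain ⟨w, -, rfl⟩ := Finset.mem_image.1 he
    rw [htgt, hatSCC_src, mem_hatSCC_verts hent, mem_hatSCC_verts hent]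
    refine ⟨?_, Or.inr ⟨w, rfl⟩⟩
    cases H.sourceIn W (f w) with
    | none => exact Or.inl rfl
    | some a => exact Or.inr ⟨a, rfl⟩
  · intro e he
    obtain ⟨w, -, rfl⟩ := Finset.mem_image.1 he
    rw [htgt]
    simp
  · intro x hx hxn
    obtain ⟨w, rfl⟩ := ((mem_hatSCC_verts hent).1 hx).resolve_left hxn
    refine ⟨f w, ⟨Finset.mem_image_of_mem _ (Finset.mem_univ _), htgt w⟩, ?_⟩
    rintro e ⟨he, hew⟩
    obtain ⟨w', -, rfl⟩ := Finset.mem_image.1 he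
    rw [htgt, Option.some_inj] at hew
    rw [Subtype.ext hew]
  · intro x hx
    rcases (mem_hatSCC_verts hent).1 hx with rfl | ⟨w, rfl⟩
    · exact .refl
    · clear hx
      induction w using hwf.induction with
      | _ w ih =>
        have hstep : (H.hatSCC W).Step (Finset.univ.image f)
            ((H.sourceIn W (f w)).map Subtype.val) (some w.1) :=
          ⟨f w, Finset.mem_image_of_mem _ (Finset.mem_univ _), hatSCC_src, htgt w⟩
        cases hs : H.sourceIn W (f w) with
        | none => exact .single (by simpa [hs] using hstep)
        | some a => exact (ih a hs).tail (by simpa [hs] using hstep)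

theorem exists_image_eq_of_isArb (hent : ∃ e ∈ H.edges, H.tgt e ∈ W ∧ H.src e ∉ W)
    {A : Finset ε} (hA : (H.hatSCC W).IsArb A) :
    ∃ f : W → ε, (∀ w, f w ∈ H.enteringEdges W w) ∧
      WellFounded (ParentRel (H.sourceIn W) f) ∧ Finset.univ.image f = A := by
  obtain ⟨r, hsub, -, -, -, huniq, hreach⟩ := hA
  obtain rfl : r = none := by
    by_contra hr
    obtain ⟨e, ⟨-, he⟩, -⟩ := huniq none ((mem_hatSCC_verts hent).2 (Or.inl rfl)) (Ne.symm hr)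
    simp [hatSCC] at he
  have hex : ∀ w : W, ∃ e, (e ∈ A ∧ (H.hatSCC W).tgt e = some w.1) ∧
      ∀ e', e' ∈ A ∧ (H.hatSCC W).tgt e' = some w.1 → e' = e := fun w =>
    huniq (some w.1) ((mem_hatSCC_verts hent).2 (Or.inr ⟨w, rfl⟩)) (by simp)
  choose f hf hfu using hex
  have hfE : ∀ w, f w ∈ H.enteringEdges W w := by
    intro w
    obtain ⟨w', hw'⟩ := mem_hatSCC_edges.1 (hsub (hf w).1)
    exact mem_enteringEdges.2 ⟨(mem_enteringEdges.1 hw').1, Option.some_inj.1 (hf w).2⟩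
  refine ⟨f, hfE, ⟨fun w => ?_⟩, ?_⟩
  · have key : ∀ x, (H.hatSCC W).Reaches A none x → ∀ w : W, x = some w.1 →
        Acc (ParentRel (H.sourceIn W) f) w := by
      intro x hx
      induction hx with
      | refl => simp
      | @tail y z _ hs ih =>
        rintro w rfl
        obtain ⟨e, he, rfl, het⟩ := hs
        obtain rfl := hfu w e ⟨he, het⟩
        refine ⟨_, fun a ha => ih a ?_⟩
        rw [hatSCC_src, show H.sourceIn W (f w) = some a from ha, Option.map_some]
    exact key _ (hreach _ ((mem_hatSCC_verts hent).2 (Or.inr ⟨w, rfl⟩))) w rfl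
  · ext e
    simp only [Finset.mem_image, Finset.mem_univ, true_and]
    constructor
    · rintro ⟨w, rfl⟩
      exact (hf w).1
    · intro he
      obtain ⟨w, hw⟩ := mem_hatSCC_edges.1 (hsub he)
      exact ⟨w, (hfu w e ⟨he, congrArg some (mem_enteringEdges.1 hw).2⟩).symm⟩

/-- When `W` is entered from outside, the arborescences of `Ĥ(W)` are rooted at the auxiliary
vertex and amount to an acyclic choice of an entering edge at each vertex of `W`. -/
theorem kirchhoff_hatSCC (hent : ∃ e ∈ H.edges, H.tgt e ∈ W ∧ H.src e ∉ W) :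
    (H.hatSCC W).kirchhoff = arbPoly (H.enteringEdges W) (H.sourceIn W) := by
  classical
  unfold kirchhoff arbPoly
  symm
  refine Finset.sum_bij (fun f _ => Finset.univ.image f) ?_ ?_ ?_ ?_
  · intro f hf
    rw [Finset.mem_filter, Fintype.mem_piFinset] at hf
    have := isArbAt_none_image hent hf.1 hf.2
    exact Finset.mem_filter.2 ⟨Finset.mem_powerset.2 this.1, _, this⟩
  · intro f hf g hg hfg
    rw [Finset.mem_filter, Fintype.mem_piFinset] at hf hg
    funext w
    have hw : f w ∈ Finset.univ.image g := hfg ▸ Finset.mem_image_of_mem _ (Finset.mem_univ w)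
    obtain ⟨w', -, hw'⟩ := Finset.mem_image.1 hw
    have : w' = w := Subtype.ext <| by
      rw [← (mem_enteringEdges.1 (hf.1 w)).2, ← (mem_enteringEdges.1 (hg.1 w')).2, hw']
    rw [← hw', this]
  · intro A hA
    obtain ⟨f, hf, hwf, rfl⟩ := exists_image_eq_of_isArb hent (Finset.mem_filter.1 hA).2
    exact ⟨f, Finset.mem_filter.2 ⟨Fintype.mem_piFinset.2 hf, hwf⟩, rfl⟩
  · intro f hf
    rw [Finset.mem_filter, Fintype.mem_piFinset] at hf
    exact (Finset.prod_image (injective_of_mem_enteringEdges hf.1).injOn).symm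

/-- If every nonempty proper subset of a strongly connected component `W` is entered from
outside while avoiding any prescribed vertex of `W`, then the Kirchhoff polynomial of `Ĥ(W)`
is prime. -/
theorem IsSCC.eq_C_or_eq_C_of_kirchhoff_hatSCC (hH : H.WellFormed) (hW : H.IsSCC W)
    (hedge : ∀ S ⊆ W, S.Nonempty → ∀ c ∈ W,
      ∃ e ∈ H.edges, H.tgt e ∈ S ∧ H.src e ∉ S ∧ H.src e ≠ c)
    {P Q : MvPolynomial ε ℚ} (hfac : (H.hatSCC W).kirchhoff = P * Q) :
    (∃ c, P = C c) ∨ ∃ c, Q = C c := by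
  obtain ⟨w₀, hw₀⟩ := hW.nonempty
  have hent : ∃ e ∈ H.edges, H.tgt e ∈ W ∧ H.src e ∉ W := by
    obtain ⟨e, he, h1, h2, -⟩ := hedge W subset_rfl hW.nonempty w₀ hw₀
    exact ⟨e, he, h1, h2⟩
  have : Nonempty W := ⟨⟨w₀, hw₀⟩⟩
  rw [kirchhoff_hatSCC hent] at hfac
  refine eq_C_or_eq_C_of_arbPoly_eq_mul
    (τ := fun e => if h : H.tgt e ∈ W then ⟨H.tgt e, h⟩ else ⟨w₀, hw₀⟩) ?_ ?_ hfac
  · intro w e he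
    have h := (mem_enteringEdges.1 he).2
    rw [dif_pos (h ▸ w.2)]
    exact Subtype.ext h
  · intro S hS hSu c
    have hmem : ∀ x : W, x.1 ∈ S.image Subtype.val ↔ x ∈ S := by simp
    have hsub : S.image Subtype.val ⊆ W := fun x hx => by
      obtain ⟨w, -, rfl⟩ := Finset.mem_image.1 hx
      exact w.2
    have hsome : ∀ {e}, H.src e ∉ S.image Subtype.val →
        ∀ w' ∈ S, H.sourceIn W e ≠ some w' := fun he w' hw' h =>
      he (sourceIn_eq_some.1 h ▸ (hmem w').2 hw')
    cases c with
    | none =>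
      obtain ⟨x, hx⟩ : ∃ x, x ∉ S := by
        by_contra! h
        exact hSu (Finset.eq_univ_of_forall h)
      obtain ⟨y, hy⟩ := hS
      obtain ⟨e, he, h1, h2, h3, h4⟩ := (hW.reaches x.2 y.2).exists_crossing
        (S := S.image Subtype.val) (fun h => hx ((hmem x).1 h)) ((hmem y).2 hy)
      obtain ⟨w, hw, hwe⟩ := Finset.mem_image.1 h2
      have hsrc : H.src e ∈ W := hW.mem_of_reaches x.2 y.2 (hH e he).1 h3
        (h4.head ⟨e, he, rfl, rfl⟩)
      exact ⟨w, hw, e, mem_enteringEdges.2 ⟨he, hwe.symm⟩,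
        fun h => sourceIn_eq_none.1 h hsrc, hsome h1⟩
    | some c =>
      obtain ⟨e, he, h1, h2, h3⟩ := hedge (S.image Subtype.val) hsub (hS.image _) c c.2
      obtain ⟨w, hw, hwe⟩ := Finset.mem_image.1 h1
      exact ⟨w, hw, e, mem_enteringEdges.2 ⟨he, hwe.symm⟩,
        fun h => h3 (sourceIn_eq_some.1 h), hsome h2⟩

end MultiDigraph

open MvPolynomial

variable {V : Type*} {ε : Type*} [DecidableEq V] [DecidableEq ε]

/-- Let `G` be rooted at `v` and let
`H = root_u(G(dom_G(u₁) → u₁; …; dom_G(u_i) → u_i)[{u, u₁, …, u_i}])` be a factor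
digraph of the dominator-tree decomposition (`{u₁, …, u_i} = imm_G(u)`).  Then for every
strongly connected component `W` of `H`, the Kirchhoff polynomial of `Ĥ(W)` is prime. -/
theorem statement_10 (G : MultiDigraph V ε) (hwf : G.WellFormed) (hsimple : G.Simple)
    (v : V) (hroot : G.RootedAt v) (u : V) (hu : u ∈ G.verts)
    (H : MultiDigraph V ε)
    (hH : H = ((G.domContract v (G.immSet v u)).induce (insert u (G.immSet v u))).rootAt u)
    (W : Finset V) (hW : H.IsSCC W)
    (P Q : MvPolynomial ε ℚ) (hfac : (H.hatSCC W).kirchhoff = P * Q) :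
    (∃ c : ℚ, P = MvPolynomial.C c) ∨ (∃ c : ℚ, Q = MvPolynomial.C c) := by
  subst hH
  by_cases huW : u ∈ W
  · obtain ⟨c, hc⟩ := hW.exists_kirchhoff_hatSCC_eq_C huW
      fun e he => (Finset.mem_filter.1 he).2
    exact MultiDigraph.eq_C_or_eq_C_of_mul_eq_C (hfac.symm.trans hc)
  · have hsub : W ⊆ G.immSet v u := fun x hx =>
      (Finset.mem_insert.1 (hW.subset_verts hx)).resolve_left fun h => huW (h ▸ hx)
    exact hW.eq_C_or_eq_C_of_kirchhoff_hatSCC MultiDigraph.domFactor_wellFormed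
      (fun S hS hne c hc => MultiDigraph.exists_edge_domFactor hwf hroot (hS.trans hsub) hne
        fun h => huW (h ▸ hc)) hfac
end

section
/- Let G = (V, E) be a digraph, v ∈ V, enumerate V ∖ {v} = {v₁, …, v_{n−1}}, and choose edges e₁ ∈ in(v₁), …, e_{n−1} ∈ in(v_{n−1}) (one incoming edge per vertex other than v). Then the subdigraph with edge set {e₁, …, e_{n−1}} is an arborescence of G rooted at v if and only if {e₁, …, e_{n−1}} contains no directed cycle. -/
open MvPolynomial

namespace MultiDigraph

variable {V ε : Type*} {G : MultiDigraph V ε} {A : Finset ε}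

theorem IsWalk.append_iff {p q : List ε} {x y : V} :
    G.IsWalk A (p ++ q) x y ↔ ∃ z, G.IsWalk A p x z ∧ G.IsWalk A q z y := by
  induction p generalizing x with
  | nil => simp [IsWalk]
  | cons e p ih => simp [IsWalk, ih, and_assoc]

theorem IsWalk.mem {p : List ε} {x y : V} (h : G.IsWalk A p x y) {e : ε} (he : e ∈ p) :
    e ∈ A := by
  induction p generalizing x with
  | nil => simp at he
  | cons f p ih =>
    obtain ⟨hf, -, hp⟩ := h
    rcases List.mem_cons.1 he with rfl | he
    exacts [hf, ih hp he]

theorem IsWalk.end_mem {p : List ε} {x y : V} (h : G.IsWalk A p x y) :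
    y = x ∨ y ∈ p.map G.tgt := by
  induction p generalizing x with
  | nil => exact .inl h.symm
  | cons f p ih =>
    rcases ih h.2.2 with rfl | hy <;> simp_all

theorem IsWalk.src_mem {p : List ε} {x y : V} (h : G.IsWalk A p x y) {e : ε} (he : e ∈ p) :
    G.src e = x ∨ G.src e ∈ p.map G.tgt := by
  induction p generalizing x with
  | nil => simp at he
  | cons f p ih =>
    obtain ⟨-, hx, hp⟩ := h
    rcases List.mem_cons.1 he with rfl | he
    · exact .inl hx
    · rcases ih hp he with h | h
      · exact .inr (by simp [h])
      · exact .inr (List.mem_cons_of_mem _ h)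

/-- Along a cycle, the source of each edge is the target of an edge of the cycle. -/
theorem IsCycle.src_mem {p : List ε} {x : V} (h : G.IsCycle A p x) {e : ε} (he : e ∈ p) :
    G.src e ∈ p.map G.tgt := by
  obtain ⟨hne, hw, -⟩ := h
  rcases hw.src_mem he with hx | hx
  · rw [hx]
    cases p with
    | nil => exact absurd rfl hne
    | cons f q =>
      rcases hw.2.2.end_mem with h | h
      · rw [h]; simp
      · exact List.mem_cons_of_mem _ h
  · exact hx

/-- A walk in an acyclic edge set never enters a vertex twice. -/
theorem Acyclic.nodup_map_tgt (hA : G.Acyclic A) {p : List ε} {x y : V} (h : G.IsWalk A p x y) :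
    (p.map G.tgt).Nodup := by
  induction p generalizing x with
  | nil => simp
  | cons e p ih =>
    have hp := ih h.2.2
    refine List.nodup_cons.2 ⟨fun hmem => hA ?_, hp⟩
    obtain ⟨f, hf, hfe⟩ := List.mem_map.1 hmem
    obtain ⟨s, t, rfl⟩ := List.append_of_mem hf
    rw [← List.singleton_append, ← List.append_assoc] at hp
    obtain ⟨z, hs, hft⟩ := IsWalk.append_iff.1 h.2.2
    refine ⟨s ++ [f], G.tgt e, by simp, ?_, ?_⟩
    · exact IsWalk.append_iff.2 ⟨z, hs, hft.1, hft.2.1, hfe⟩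
    · rw [List.map_append] at hp
      exact hp.of_append_left

theorem exists_isWalk_of_transGen {x y : V} (h : Relation.TransGen (G.Step A) x y) :
    ∃ p ≠ [], G.IsWalk A p x y := by
  induction h with
  | single h =>
    obtain ⟨e, he, hx, hy⟩ := h
    exact ⟨[e], by simp, he, hx, hy⟩
  | tail _ h ih =>
    obtain ⟨e, he, hx, hy⟩ := h
    obtain ⟨p, -, hp⟩ := ih
    exact ⟨p ++ [e], by simp, IsWalk.append_iff.2 ⟨_, hp, he, hx, hy⟩⟩

theorem Acyclic.not_transGen_self (hA : G.Acyclic A) (x : V) :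
    ¬ Relation.TransGen (G.Step A) x x := fun h =>
  let ⟨p, hne, hp⟩ := exists_isWalk_of_transGen h
  hA ⟨p, x, hne, hp, hA.nodup_map_tgt hp⟩

/-- If every vertex other than `r` has an incoming edge in the acyclic edge set `A`, then `r`
reaches every vertex. -/
theorem Acyclic.reaches (hA : G.Acyclic A) {r : V}
    (hin : ∀ w ∈ G.verts, w ≠ r → ∃ e ∈ A, G.src e ∈ G.verts ∧ G.tgt e = w)
    {w : V} (hw : w ∈ G.verts) : G.Reaches A r w := by
  have : IsStrictOrder V (Relation.TransGen (G.Step A)) :=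
    { irrefl := hA.not_transGen_self
      trans := fun _ _ _ => Relation.TransGen.trans }
  have hwf : (G.verts : Set V).WellFoundedOn (Relation.TransGen (G.Step A)) :=
    G.verts.finite_toSet.wellFoundedOn
  refine hwf.induction hw fun y hy ih => ?_
  by_cases hyr : y = r
  · exact hyr ▸ Relation.ReflTransGen.refl
  · obtain ⟨e, he, hsrc, htgt⟩ := hin y hy hyr
    have hstep : G.Step A (G.src e) y := ⟨e, he, rfl, htgt⟩
    exact (ih _ hsrc (.single hstep)).tail hstep

/-- An arborescence contains no directed cycle. -/
theorem IsArbAt.acyclic {r : V} (h : G.IsArbAt A r) : G.Acyclic A := by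
  obtain ⟨-, -, hends, hroot, huniq, hreach⟩ := h
  rintro ⟨p, x, hp⟩
  have closed : ∀ a b, G.Step A a b → b ∈ p.map G.tgt → a ∈ p.map G.tgt := by
    rintro _ _ ⟨e, he, rfl, rfl⟩ hb
    obtain ⟨f, hf, hfe⟩ := List.mem_map.1 hb
    obtain rfl : f = e :=
      (huniq _ (hends e he).2 (hroot e he)).unique ⟨hp.2.1.mem hf, hfe⟩ ⟨he, rfl⟩
    exact hp.src_mem hf
  obtain ⟨e, he⟩ := List.exists_mem_of_ne_nil p hp.1
  have hr : r ∈ p.map G.tgt := by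
    refine Relation.ReflTransGen.head_induction_on
      (hreach (G.tgt e) (hends e (hp.2.1.mem he)).2) (List.mem_map_of_mem he) ?_
    exact fun hab _ hb => closed _ _ hab hb
  obtain ⟨f, hf, hfr⟩ := List.mem_map.1 hr
  exact hroot f (hp.2.1.mem hf) hfr

end MultiDigraph

open MvPolynomial

variable {V : Type*} {ε : Type*} [DecidableEq V] [DecidableEq ε]

/-- A choice of one incoming edge for each vertex other than `v` forms
an arborescence of `G` rooted at `v` iff the chosen edge set contains no directed
cycle. -/
theorem statement_15 (G : MultiDigraph V ε) (hwf : G.WellFormed) (hsimple : G.Simple)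
    (v : V) (hv : v ∈ G.verts)
    (c : ∀ w ∈ G.verts.erase v, ε)
    (hc : ∀ w (hw : w ∈ G.verts.erase v), c w hw ∈ G.inEdges w) :
    G.IsArbAt ((G.verts.erase v).attach.image (fun w => c w.1 w.2)) v ↔
      G.Acyclic ((G.verts.erase v).attach.image (fun w => c w.1 w.2)) := by
  refine ⟨MultiDigraph.IsArbAt.acyclic, fun hA => ?_⟩
  have hedge : ∀ w (hw : w ∈ G.verts.erase v), c w hw ∈ G.edges ∧ G.tgt (c w hw) = w :=
    fun w hw => Finset.mem_filter.1 (hc w hw)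
  have hmem : ∀ e, e ∈ (G.verts.erase v).attach.image (fun w => c w.1 w.2) ↔
      ∃ w, ∃ hw : w ∈ G.verts.erase v, c w hw = e := by
    simp
  refine ⟨?_, hv, ?_, ?_, ?_, fun w hw => hA.reaches ?_ hw⟩
  · intro e he
    obtain ⟨w, hw, rfl⟩ := (hmem e).1 he
    exact (hedge w hw).1
  · intro e he
    obtain ⟨w, hw, rfl⟩ := (hmem e).1 he
    exact hwf _ (hedge w hw).1
  · intro e he
    obtain ⟨w, hw, rfl⟩ := (hmem e).1 he
    rw [(hedge w hw).2]
    exact Finset.ne_of_mem_erase hw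
  · intro w hw hwv
    have hw' : w ∈ G.verts.erase v := Finset.mem_erase.2 ⟨hwv, hw⟩
    refine ⟨c w hw', ⟨(hmem _).2 ⟨w, hw', rfl⟩, (hedge w hw').2⟩, ?_⟩
    rintro e ⟨he, rfl⟩
    obtain ⟨u, hu, rfl⟩ := (hmem e).1 he
    have := (hedge u hu).2
    congr 1
    exact this.symm
  · intro u hu huv
    have hu' : u ∈ G.verts.erase v := Finset.mem_erase.2 ⟨huv, hu⟩
    exact ⟨c u hu', (hmem _).2 ⟨u, hu', rfl⟩, (hwf _ (hedge u hu').1).1, (hedge u hu').2⟩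
end
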